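/- arXiv:2405.12024 — 15 statements merged into one kernel-verified Lean document; each statement's English description precedes it below -/
import Mathlib

section
/- The polynomials Q_n and R_n satisfy Q_0 = 1, Q_1 = xy + x + y + z, R_0 = 1, R_1 = x + y, and for all n ≥ 1 the three-term recurrences Q_{n+1} = (xy + x + y + z)·Q_n − (x²y + xy² + yz)·Q_{n−1} and R_{n+1} = (xy + x + y + z)·R_n − (x²y + xy² + yz)·R_{n−1} hold in ℤ[x,y,z]. -/
open MvPolynomial

/-- Proposition 3.1: with `Q n = p (2^(n+1) - 2)` and `R n = p (2^n - 1)`, we have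
`Q 0 = 1`, `Q 1 = xy+x+y+z`, `R 0 = 1`, `R 1 = x+y`, and for `n ≥ 1` the three-term
recurrences hold. -/
theorem binary_overpartition_QR_recurrences
    (p : ℕ → MvPolynomial (Fin 3) ℤ)
    (hp0 : p 0 = 1)
    (hp1 : p 1 = X 0 + X 1)
    (hpeven : ∀ n : ℕ, 1 ≤ n →
      p (2 * n) = p n + (X 2 + X 0 * X 1) * p (n - 1))
    (hpodd : ∀ n : ℕ, 1 ≤ n →
      p (2 * n + 1) = (X 0 + X 1) * p n + X 0 * X 2 * p (n - 1)) :
    p (2 ^ (0 + 1) - 2) = 1 ∧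
    p (2 ^ (1 + 1) - 2) = X 0 * X 1 + X 0 + X 1 + X 2 ∧
    p (2 ^ 0 - 1) = 1 ∧
    p (2 ^ 1 - 1) = X 0 + X 1 ∧
    (∀ n : ℕ, 1 ≤ n →
      p (2 ^ (n + 1 + 1) - 2) =
        (X 0 * X 1 + X 0 + X 1 + X 2) * p (2 ^ (n + 1) - 2) -
          (X 0 ^ 2 * X 1 + X 0 * X 1 ^ 2 + X 1 * X 2) * p (2 ^ n - 2) ∧
      p (2 ^ (n + 1) - 1) =
        (X 0 * X 1 + X 0 + X 1 + X 2) * p (2 ^ n - 1) -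
          (X 0 ^ 2 * X 1 + X 0 * X 1 ^ 2 + X 1 * X 2) * p (2 ^ (n - 1) - 1)) := by
  have hQ (k : ℕ) : p (2 ^ (k + 2) - 2) =
      p (2 ^ (k + 1) - 1) + (X 2 + X 0 * X 1) * p (2 ^ (k + 1) - 2) := by
    have hpos : 0 < 2 ^ k := by positivity
    have hpow : 2 ^ (k + 2) = 2 * 2 ^ (k + 1) := pow_succ' 2 (k + 1)
    have h := hpeven (2 ^ (k + 1) - 1) (by omega)
    rwa [show 2 * (2 ^ (k + 1) - 1) = 2 ^ (k + 2) - 2 by omega,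
      show 2 ^ (k + 1) - 1 - 1 = 2 ^ (k + 1) - 2 by omega] at h
  have hR (k : ℕ) : p (2 ^ (k + 2) - 1) =
      (X 0 + X 1) * p (2 ^ (k + 1) - 1) + X 0 * X 2 * p (2 ^ (k + 1) - 2) := by
    have hpos : 0 < 2 ^ k := by positivity
    have hpow : 2 ^ (k + 2) = 2 * 2 ^ (k + 1) := pow_succ' 2 (k + 1)
    have h := hpodd (2 ^ (k + 1) - 1) (by omega)
    rwa [show 2 * (2 ^ (k + 1) - 1) + 1 = 2 ^ (k + 2) - 1 by omega,
      show 2 ^ (k + 1) - 1 - 1 = 2 ^ (k + 1) - 2 by omega] at h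
  have hQ₀ : p (2 ^ (0 + 1) - 2) = 1 := hp0
  have hR₁ : p (2 ^ (0 + 1) - 1) = X 0 + X 1 := hp1
  refine ⟨hQ₀, ?_, hp0, hp1, fun n hn => ?_⟩
  · linear_combination hQ 0 + hR₁ + (X 2 + X 0 * X 1) * hQ₀
  obtain ⟨k, rfl⟩ := Nat.exists_eq_add_of_le' hn
  constructor
  · linear_combination hQ (k + 1) + hR k - (X 0 + X 1) * hQ k
  · rw [Nat.add_sub_cancel]
    cases k with
    | zero =>
      have hR₀ : p (2 ^ 0 - 1) = 1 := hp0
      rw [hR 0, hR₀, hR₁, hQ₀]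
      ring
    | succ j =>
      linear_combination hR (j + 1) + X 0 * X 2 * hQ j - (X 2 + X 0 * X 1) * hR j
end

section
/- For every n ≥ 0 and every real number x, evaluating the specialized polynomials gives Qx_n(x) = (1 + x + x²)^{n/2} · U_n((1 + x)/√(1 + x + x²)) and Rx_n(x) = (1 + x + x²)^{n/2} · T_n((1 + x)/√(1 + x + x²)), where U_n and T_n are the Chebyshev polynomials of the second and first kind and (1 + x + x²)^{n/2} means the n-th power of the (positive) real square root of 1 + x + x². -/
open MvPolynomial

open Polynomial.Chebyshev in
/-- Multiplying by powers of `s` homogenizes the mixed recurrences of the Chebyshev polynomials: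
a pair of sequences with `Q (n+1) = R (n+1) + a Q n` and `R (n+2) = a R (n+1) + (a² - s²) Q n`
is given by `U` and `T` at `a / s`. -/
theorem eq_pow_mul_chebyshev_of_recurrence {K : Type*} [Field K] {a s : K} (hs : s ≠ 0)
    {Q R : ℕ → K} (hQ0 : Q 0 = 1) (hR1 : R 1 = a)
    (hQ : ∀ n, Q (n + 1) = R (n + 1) + a * Q n)
    (hR : ∀ n, R (n + 2) = a * R (n + 1) + (a ^ 2 - s ^ 2) * Q n) (n : ℕ) :
    Q n = s ^ n * Polynomial.eval (a / s) (U K (n : ℤ)) ∧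
      R (n + 1) = s ^ (n + 1) * Polynomial.eval (a / s) (T K ((n : ℤ) + 1)) := by
  induction n with
  | zero => simp [hQ0, hR1, mul_div_cancel₀ a hs]
  | succ n ih =>
    obtain ⟨ihQ, ihR⟩ := ih
    constructor
    · rw [hQ, ihQ, ihR]
      push_cast
      rw [U_eq_X_mul_U_add_T]
      simp only [Polynomial.eval_add, Polynomial.eval_mul, Polynomial.eval_X]
      field_simp
      ring
    · rw [hR, ihQ, ihR]
      push_cast
      rw [show (n : ℤ) + 1 + 1 = n + 2 by ring, T_eq_X_mul_T_sub_pol_U]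
      simp only [Polynomial.eval_sub, Polynomial.eval_mul, Polynomial.eval_X,
        Polynomial.eval_pow, Polynomial.eval_one]
      field_simp
      ring

/-- Corollary 4.1: with `Qx n`, `Rx n` the polynomials in ℤ[x] obtained from
`Q n = p (2^(n+1)-2)` resp. `R n = p (2^n-1)` by substituting y = z = 1, we have
`Qx n (x) = (1+x+x²)^{n/2} U_n((1+x)/√(1+x+x²))` and likewise with `T_n` for `Rx n`. -/
theorem binary_overpartition_Qx_Rx_chebyshev
    (p : ℕ → MvPolynomial (Fin 3) ℤ)
    (hp0 : p 0 = 1)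
    (hp1 : p 1 = X 0 + X 1)
    (hpeven : ∀ n : ℕ, 1 ≤ n →
      p (2 * n) = p n + (X 2 + X 0 * X 1) * p (n - 1))
    (hpodd : ∀ n : ℕ, 1 ≤ n →
      p (2 * n + 1) = (X 0 + X 1) * p n + X 0 * X 2 * p (n - 1)) :
    ∀ n : ℕ, ∀ x : ℝ,
      Polynomial.aeval x
          (MvPolynomial.aeval ![Polynomial.X, 1, 1] (p (2 ^ (n + 1) - 2)) : Polynomial ℤ) =
        Real.sqrt (1 + x + x ^ 2) ^ n *
          Polynomial.eval ((1 + x) / Real.sqrt (1 + x + x ^ 2))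
            (Polynomial.Chebyshev.U ℝ (n : ℤ)) ∧
      Polynomial.aeval x
          (MvPolynomial.aeval ![Polynomial.X, 1, 1] (p (2 ^ n - 1)) : Polynomial ℤ) =
        Real.sqrt (1 + x + x ^ 2) ^ n *
          Polynomial.eval ((1 + x) / Real.sqrt (1 + x + x ^ 2))
            (Polynomial.Chebyshev.T ℝ (n : ℤ)) := by
  intro n x
  have hpos : 0 < 1 + x + x ^ 2 := by nlinarith [sq_nonneg (1 + 2 * x)]
  have hsq : Real.sqrt (1 + x + x ^ 2) ^ 2 = 1 + x + x ^ 2 := Real.sq_sqrt hpos.le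
  have key := eq_pow_mul_chebyshev_of_recurrence (a := 1 + x)
    (s := Real.sqrt (1 + x + x ^ 2)) (Real.sqrt_ne_zero'.mpr hpos)
    (Q := fun n => Polynomial.aeval x
      (MvPolynomial.aeval ![Polynomial.X, 1, 1] (p (2 ^ (n + 1) - 2)) : Polynomial ℤ))
    (R := fun n => Polynomial.aeval x
      (MvPolynomial.aeval ![Polynomial.X, 1, 1] (p (2 ^ n - 1)) : Polynomial ℤ))
    (by simp [hp0]) (by simp [hp1, add_comm])
    (fun n => by
      have hn : 1 ≤ 2 ^ n := Nat.one_le_two_pow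
      have h := hpeven (2 ^ (n + 1) - 1) (by omega)
      rw [show 2 * (2 ^ (n + 1) - 1) = 2 ^ (n + 1 + 1) - 2 by omega,
        show 2 ^ (n + 1) - 1 - 1 = 2 ^ (n + 1) - 2 by omega] at h
      simp [h])
    (fun n => by
      have hn : 1 ≤ 2 ^ n := Nat.one_le_two_pow
      have h := hpodd (2 ^ (n + 1) - 1) (by omega)
      rw [show 2 * (2 ^ (n + 1) - 1) + 1 = 2 ^ (n + 1 + 1) - 1 by omega,
        show 2 ^ (n + 1) - 1 - 1 = 2 ^ (n + 1) - 2 by omega] at h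
      simp only [show n + 2 = n + 1 + 1 from rfl, h, hsq]
      simp
      ring)
  refine ⟨(key n).1, ?_⟩
  cases n with
  | zero => simp [hp0]
  | succ n => exact_mod_cast (key n).2
end

section
/- For every n ≥ 1, the polynomials Qx_n and Rx_n are palindromic of degree n: both have degree n, and for all 0 ≤ j ≤ n the coefficient of x^j in Qx_n equals the coefficient of x^{n−j} in Qx_n, and likewise for Rx_n. -/
open MvPolynomial

/-- `f` has degree at most `n` and is fixed by the reversal `x ^ j ↦ x ^ (n - j)`. -/
def IsReflectInvariant (n : ℕ) (f : Polynomial ℤ) : Prop :=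
  f.natDegree ≤ n ∧ f.reflect n = f

namespace IsReflectInvariant

theorem add {n : ℕ} {f g : Polynomial ℤ} (hf : IsReflectInvariant n f)
    (hg : IsReflectInvariant n g) : IsReflectInvariant n (f + g) :=
  ⟨Polynomial.natDegree_add_le_of_degree_le hf.1 hg.1, by
    rw [Polynomial.reflect_add, hf.2, hg.2]⟩

theorem mul {m n : ℕ} {f g : Polynomial ℤ} (hf : IsReflectInvariant m f)
    (hg : IsReflectInvariant n g) : IsReflectInvariant (m + n) (f * g) :=
  ⟨Polynomial.natDegree_mul_le_of_le hf.1 hg.1, by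
    rw [Polynomial.reflect_mul f g hf.1 hg.1, hf.2, hg.2]⟩

theorem one : IsReflectInvariant 0 1 := by
  simp [IsReflectInvariant, Polynomial.reflect_one]

theorem X_two : IsReflectInvariant 2 Polynomial.X := by
  refine ⟨Polynomial.natDegree_X_le.trans one_le_two, ?_⟩
  simpa [Polynomial.revAt_le] using Polynomial.reflect_monomial (R := ℤ) 2 1

theorem X_add_one : IsReflectInvariant 1 (Polynomial.X + 1) := by
  refine ⟨Polynomial.natDegree_add_le_of_degree_le Polynomial.natDegree_X_le (by simp), ?_⟩
  have h := Polynomial.reflect_monomial (R := ℤ) 1 1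
  simp only [pow_one, Polynomial.revAt_le le_rfl, Nat.sub_self, pow_zero] at h
  rw [Polynomial.reflect_add, h, Polynomial.reflect_one, pow_one, add_comm]

theorem coeff_eq {n : ℕ} {f : Polynomial ℤ} (hf : IsReflectInvariant n f) {j : ℕ}
    (hj : j ≤ n) : f.coeff j = f.coeff (n - j) := by
  conv_lhs => rw [← hf.2]
  rw [Polynomial.coeff_reflect, Polynomial.revAt_le hj]

theorem natDegree_eq {n : ℕ} {f : Polynomial ℤ} (hf : IsReflectInvariant n f)
    (h0 : 0 < f.coeff 0) : f.natDegree = n := by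
  refine Polynomial.natDegree_eq_of_le_of_coeff_ne_zero hf.1 ?_
  have h := hf.coeff_eq n.zero_le
  rw [Nat.sub_zero] at h
  exact h ▸ h0.ne'

end IsReflectInvariant

/-- Sequences coupled by `r (n + 2) = (x + 1) r (n + 1) + x q n` and
`q (n + 1) = r (n + 1) + (x + 1) q n` consist of palindromic polynomials with positive
constant coefficient. -/
theorem isReflectInvariant_of_recurrence {q r : ℕ → Polynomial ℤ}
    (hq0 : q 0 = 1) (hr1 : r 1 = Polynomial.X + 1)
    (hq : ∀ n, q (n + 1) = r (n + 1) + (Polynomial.X + 1) * q n)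
    (hr : ∀ n, r (n + 2) = (Polynomial.X + 1) * r (n + 1) + Polynomial.X * q n) (n : ℕ) :
    (IsReflectInvariant n (q n) ∧ 0 < (q n).coeff 0) ∧
      (IsReflectInvariant (n + 1) (r (n + 1)) ∧ 0 < (r (n + 1)).coeff 0) := by
  induction n with
  | zero =>
    rw [hq0, zero_add, hr1]
    exact ⟨⟨.one, by simp⟩, .X_add_one, by simp⟩
  | succ n ih =>
    obtain ⟨⟨hqn, hqn0⟩, hrn, hrn0⟩ := ih
    rw [hq, hr]
    refine ⟨⟨hrn.add ?_, ?_⟩, .add ?_ ?_, ?_⟩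
    · simpa only [add_comm] using IsReflectInvariant.X_add_one.mul hqn
    · simpa [Polynomial.mul_coeff_zero] using add_pos hrn0 hqn0
    · simpa only [add_comm] using IsReflectInvariant.X_add_one.mul hrn
    · have h := IsReflectInvariant.X_two.mul hqn
      rwa [add_comm] at h
    · simpa [Polynomial.mul_coeff_zero] using hrn0

/-- Corollary 4.2(a): for n ≥ 1, `Qx n` and `Rx n` are palindromic of degree n. -/
theorem binary_overpartition_Qx_Rx_palindromic
    (p : ℕ → MvPolynomial (Fin 3) ℤ)
    (hp0 : p 0 = 1)
    (hp1 : p 1 = X 0 + X 1)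
    (hpeven : ∀ n : ℕ, 1 ≤ n →
      p (2 * n) = p n + (X 2 + X 0 * X 1) * p (n - 1))
    (hpodd : ∀ n : ℕ, 1 ≤ n →
      p (2 * n + 1) = (X 0 + X 1) * p n + X 0 * X 2 * p (n - 1)) :
    ∀ n : ℕ, 1 ≤ n →
      (MvPolynomial.aeval ![Polynomial.X, 1, 1] (p (2 ^ (n + 1) - 2)) :
          Polynomial ℤ).natDegree = n ∧
      (∀ j : ℕ, j ≤ n →
        (MvPolynomial.aeval ![Polynomial.X, 1, 1] (p (2 ^ (n + 1) - 2)) :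
            Polynomial ℤ).coeff j =
          (MvPolynomial.aeval ![Polynomial.X, 1, 1] (p (2 ^ (n + 1) - 2)) :
              Polynomial ℤ).coeff (n - j)) ∧
      (MvPolynomial.aeval ![Polynomial.X, 1, 1] (p (2 ^ n - 1)) :
          Polynomial ℤ).natDegree = n ∧
      (∀ j : ℕ, j ≤ n →
        (MvPolynomial.aeval ![Polynomial.X, 1, 1] (p (2 ^ n - 1)) :
            Polynomial ℤ).coeff j =
          (MvPolynomial.aeval ![Polynomial.X, 1, 1] (p (2 ^ n - 1)) :
              Polynomial ℤ).coeff (n - j)) := by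
  have key := isReflectInvariant_of_recurrence
    (q := fun n => MvPolynomial.aeval ![Polynomial.X, 1, 1] (p (2 ^ (n + 1) - 2)))
    (r := fun n => MvPolynomial.aeval ![Polynomial.X, 1, 1] (p (2 ^ n - 1)))
    (by simp [hp0]) (by simp [hp1])
    (fun n => by
      have hpos : 1 ≤ 2 ^ n := Nat.one_le_two_pow
      have h := hpeven (2 ^ (n + 1) - 1) (by omega)
      rw [show 2 * (2 ^ (n + 1) - 1) = 2 ^ (n + 1 + 1) - 2 by omega,
        show 2 ^ (n + 1) - 1 - 1 = 2 ^ (n + 1) - 2 by omega] at h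
      simp [h, add_comm (1 : Polynomial ℤ)])
    (fun n => by
      have hpos : 1 ≤ 2 ^ n := Nat.one_le_two_pow
      have hpow : 2 ^ (n + 2) = 2 * 2 ^ (n + 1) := pow_succ' 2 (n + 1)
      have h := hpodd (2 ^ (n + 1) - 1) (by omega)
      rw [show 2 * (2 ^ (n + 1) - 1) + 1 = 2 ^ (n + 2) - 1 by omega,
        show 2 ^ (n + 1) - 1 - 1 = 2 ^ (n + 1) - 2 by omega] at h
      simp [h])
  intro n hn
  obtain ⟨hq, hq0⟩ := (key n).1
  obtain ⟨m, rfl⟩ := Nat.exists_eq_add_of_le' hn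
  obtain ⟨hr, hr0⟩ := (key m).2
  exact ⟨hq.natDegree_eq hq0, fun _ hj => hq.coeff_eq hj,
    hr.natDegree_eq hr0, fun _ hj => hr.coeff_eq hj⟩
end

section
/- For every n ≥ 1, every complex zero w of Qx_n (and likewise every complex zero of Rx_n) is a negative real number; moreover, if w is such a zero and w ≠ −1, then 1/w is also a zero of the same polynomial. -/
open MvPolynomial

/-- The pair `(A, B)` with `A + t * B = (1 + t ^ 2 + t) ^ n` whenever `t ^ 2 = x`. -/
def trinomialPair {R : Type*} [CommRing R] (x : R) : ℕ → R × R
  | 0 => (1, 0)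
  | n + 1 =>
    ((1 + x) * (trinomialPair x n).1 + x * (trinomialPair x n).2,
      (trinomialPair x n).1 + (1 + x) * (trinomialPair x n).2)

lemma trinomialPair_add_mul {R : Type*} [CommRing R] (t : R) (n : ℕ) :
    (trinomialPair (t ^ 2) n).1 + t * (trinomialPair (t ^ 2) n).2 = (1 + t ^ 2 + t) ^ n := by
  induction n with
  | zero => simp [trinomialPair]
  | succ n ih => rw [pow_succ _ n, ← ih, trinomialPair]; ring

lemma trinomialPair_zero {R : Type*} [CommRing R] (n : ℕ) :
    trinomialPair (0 : R) n = (1, (n : R)) := by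
  induction n with
  | zero => simp [trinomialPair]
  | succ n ih => simp [trinomialPair, ih, add_comm]

lemma trinomialPair_inv {K : Type*} [Field K] {w : K} (hw : w ≠ 0) (n : ℕ) :
    w ^ n * (trinomialPair w⁻¹ n).1 = (trinomialPair w n).1 ∧
      w ^ n * (trinomialPair w⁻¹ n).2 = w * (trinomialPair w n).2 := by
  induction n with
  | zero => simp [trinomialPair]
  | succ n ih =>
    obtain ⟨h₁, h₂⟩ := ih
    have h : w * w⁻¹ = 1 := mul_inv_cancel₀ hw
    simp only [trinomialPair]
    constructor
    · linear_combination (w + 1) * h₁ + h₂ +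
        w ^ n * ((trinomialPair w⁻¹ n).1 + (trinomialPair w⁻¹ n).2) * h
    · linear_combination w * h₁ + (w + 1) * h₂ + w ^ n * (trinomialPair w⁻¹ n).2 * h

lemma re_eq_zero_of_norm_one_add_sq_add_eq {t : ℂ}
    (h : ‖1 + t ^ 2 + t‖ = ‖1 + t ^ 2 - t‖) : t.re = 0 := by
  have h' : Complex.normSq (1 + t ^ 2 + t) = Complex.normSq (1 + t ^ 2 - t) := by
    rw [Complex.normSq_eq_norm_sq, Complex.normSq_eq_norm_sq, h]
  simp only [Complex.normSq_apply, Complex.add_re, Complex.sub_re, Complex.add_im,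
    Complex.sub_im, Complex.one_re, Complex.one_im, pow_two, Complex.mul_re, Complex.mul_im] at h'
  have hprod : t.re * (1 + t.re ^ 2 + t.im ^ 2) = 0 := by linear_combination h' / 4
  exact (mul_eq_zero.mp hprod).resolve_right (by positivity)

lemma exists_neg_of_trinomialPair_eq_zero {w : ℂ} {n : ℕ} (hn : n ≠ 0)
    (h : (trinomialPair w n).1 = 0 ∨ (trinomialPair w n).2 = 0) :
    ∃ r : ℝ, r < 0 ∧ w = (r : ℂ) := by
  have hw : w ≠ 0 := by
    rintro rfl
    simp [trinomialPair_zero, hn] at h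
  obtain ⟨t, rfl⟩ : ∃ t : ℂ, w = t ^ 2 :=
    IsSquare.exists_sq w (IsAlgClosed.exists_eq_mul_self w)
  have hplus := trinomialPair_add_mul t n
  have hminus := trinomialPair_add_mul (-t) n
  rw [neg_sq, ← sub_eq_add_neg] at hminus
  have hnorm : ‖1 + t ^ 2 + t‖ ^ n = ‖1 + t ^ 2 - t‖ ^ n := by
    rw [← norm_pow, ← norm_pow, ← hplus, ← hminus]
    rcases h with h | h <;> simp [h]
  have hre := re_eq_zero_of_norm_one_add_sq_add_eq
    ((pow_left_inj₀ (norm_nonneg _) (norm_nonneg _) hn).mp hnorm)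
  have ht : t = t.im * Complex.I := by
    apply Complex.ext <;> simp [hre]
  have him : t.im ≠ 0 := by
    intro h0
    rw [h0] at ht
    simp [ht] at hw
  refine ⟨-t.im ^ 2, neg_neg_of_pos (by positivity), ?_⟩
  conv_lhs => rw [ht]
  rw [mul_pow, Complex.I_sq]
  push_cast
  ring

lemma trinomialPair_eq_of_binary_recurrence {R : Type*} [CommRing R] {x : R} {f : ℕ → R}
    (h0 : f 0 = 1) (h1 : f 1 = x + 1)
    (heven : ∀ n, 1 ≤ n → f (2 * n) = f n + (1 + x) * f (n - 1))
    (hodd : ∀ n, 1 ≤ n → f (2 * n + 1) = (x + 1) * f n + x * f (n - 1)) (n : ℕ) :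
    trinomialPair x (n + 1) = (f (2 ^ (n + 1) - 1), f (2 ^ (n + 1) - 2)) := by
  induction n with
  | zero => simp [trinomialPair, h0, h1, add_comm]
  | succ n ih =>
    have hpow : 2 ≤ 2 ^ (n + 1) := Nat.le_self_pow n.succ_ne_zero 2
    have hR : 2 ^ (n + 1 + 1) - 1 = 2 * (2 ^ (n + 1) - 1) + 1 := by
      rw [pow_succ _ (n + 1)]; omega
    have hQ : 2 ^ (n + 1 + 1) - 2 = 2 * (2 ^ (n + 1) - 1) := by
      rw [pow_succ _ (n + 1)]; omega
    rw [trinomialPair, ih, hR, hQ, hodd _ (by omega), heven _ (by omega), Nat.sub_sub,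
      add_comm x 1]

/-- Corollary 4.2(b): for n ≥ 1, every complex zero of `Qx n` (resp. `Rx n`) is a
negative real number, and apart from -1 the zeros come in pairs w, 1/w. -/
theorem binary_overpartition_Qx_Rx_zeros_real_negative
    (p : ℕ → MvPolynomial (Fin 3) ℤ)
    (hp0 : p 0 = 1)
    (hp1 : p 1 = X 0 + X 1)
    (hpeven : ∀ n : ℕ, 1 ≤ n →
      p (2 * n) = p n + (X 2 + X 0 * X 1) * p (n - 1))
    (hpodd : ∀ n : ℕ, 1 ≤ n →
      p (2 * n + 1) = (X 0 + X 1) * p n + X 0 * X 2 * p (n - 1)) :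
    ∀ n : ℕ, 1 ≤ n → ∀ w : ℂ,
      (Polynomial.aeval w
            (MvPolynomial.aeval ![Polynomial.X, 1, 1] (p (2 ^ (n + 1) - 2)) :
              Polynomial ℤ) = 0 →
        (∃ r : ℝ, r < 0 ∧ w = (r : ℂ)) ∧
        (w ≠ -1 →
          Polynomial.aeval w⁻¹
              (MvPolynomial.aeval ![Polynomial.X, 1, 1] (p (2 ^ (n + 1) - 2)) :
                Polynomial ℤ) = 0)) ∧
      (Polynomial.aeval w
            (MvPolynomial.aeval ![Polynomial.X, 1, 1] (p (2 ^ n - 1)) :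
              Polynomial ℤ) = 0 →
        (∃ r : ℝ, r < 0 ∧ w = (r : ℂ)) ∧
        (w ≠ -1 →
          Polynomial.aeval w⁻¹
              (MvPolynomial.aeval ![Polynomial.X, 1, 1] (p (2 ^ n - 1)) :
                Polynomial ℤ) = 0)) := by
  intro n hn w
  obtain ⟨m, rfl⟩ := Nat.exists_eq_add_of_le' hn
  have hpair (v : ℂ) := trinomialPair_eq_of_binary_recurrence (x := v)
    (f := fun k => Polynomial.aeval v
      (MvPolynomial.aeval ![Polynomial.X, 1, 1] (p k) : Polynomial ℤ))
    (by simp [hp0]) (by simp [hp1])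
    (fun k hk => by simp [hpeven k hk]) (fun k hk => by simp [hpodd k hk])
  have hR (v : ℂ) := congrArg Prod.fst (hpair v m)
  have hQ (v : ℂ) := congrArg Prod.snd (hpair v (m + 1))
  dsimp only at hR hQ
  simp only [← hR, ← hQ]
  have hne {r : ℝ} (hr : r < 0) : (r : ℂ) ≠ 0 := Complex.ofReal_ne_zero.mpr hr.ne
  refine ⟨fun h => ?_, fun h => ?_⟩
  · obtain ⟨r, hr, rfl⟩ := exists_neg_of_trinomialPair_eq_zero (m + 1).succ_ne_zero (.inr h)
    refine ⟨⟨r, hr, rfl⟩, fun _ => ?_⟩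
    have hinv := (trinomialPair_inv (hne hr) (m + 1 + 1)).2
    rw [h, mul_zero] at hinv
    exact (mul_eq_zero.mp hinv).resolve_left (pow_ne_zero _ (hne hr))
  · obtain ⟨r, hr, rfl⟩ := exists_neg_of_trinomialPair_eq_zero m.succ_ne_zero (.inl h)
    refine ⟨⟨r, hr, rfl⟩, fun _ => ?_⟩
    have hinv := (trinomialPair_inv (hne hr) (m + 1)).1
    rw [h] at hinv
    exact (mul_eq_zero.mp hinv).resolve_left (pow_ne_zero _ (hne hr))
end

section
/- The sequence (Qx_{n−1})_{n≥1} is a divisibility sequence: for all positive integers m, n, if m divides n then Qx_{m−1} divides Qx_{n−1} in ℤ[x]. -/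
open MvPolynomial

/-- Addition formulas for the coordinates of `(c + √d) ^ (n + 1) = b n + a n * √d`. -/
lemma coupled_recurrence_add {R : Type*} [CommRing R] {c d : R} {a b : ℕ → R}
    (ha0 : a 0 = 1) (hb0 : b 0 = c) (ha : ∀ n, a (n + 1) = b n + c * a n)
    (hb : ∀ n, b (n + 1) = c * b n + d * a n) (m k : ℕ) :
    a (m + k + 1) = a m * b k + b m * a k ∧ b (m + k + 1) = b m * b k + d * a m * a k := by
  induction k with
  | zero =>
    rw [add_zero, ha, hb, ha0, hb0]
    constructor <;> ring
  | succ k ih =>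
    rw [← add_assoc m k 1, ha (m + k + 1), hb (m + k + 1), ih.1, ih.2, ha k, hb k]
    constructor <;> ring

lemma coupled_recurrence_dvd {R : Type*} [CommRing R] {c d : R} {a b : ℕ → R}
    (ha0 : a 0 = 1) (hb0 : b 0 = c) (ha : ∀ n, a (n + 1) = b n + c * a n)
    (hb : ∀ n, b (n + 1) = c * b n + d * a n) (m k : ℕ) :
    a m ∣ a ((m + 1) * k + m) := by
  induction k with
  | zero => simp
  | succ k ih =>
    rw [show (m + 1) * (k + 1) + m = ((m + 1) * k + m) + m + 1 by ring,
      (coupled_recurrence_add ha0 hb0 ha hb _ m).1]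
    exact dvd_add (ih.mul_right _) (dvd_mul_left _ _)

/-- Corollary 4.2(c): `(Qx (n-1))` is a divisibility sequence:
if m ∣ n then `Qx (m-1) ∣ Qx (n-1)` in ℤ[x].  Here `Qx k = p (2^(k+1)-2)` with
y = z = 1 substituted, so `Qx (m-1)` corresponds to `p (2^m - 2)`. -/
theorem binary_overpartition_Qx_divisibility_sequence
    (p : ℕ → MvPolynomial (Fin 3) ℤ)
    (hp0 : p 0 = 1)
    (hp1 : p 1 = X 0 + X 1)
    (hpeven : ∀ n : ℕ, 1 ≤ n →
      p (2 * n) = p n + (X 2 + X 0 * X 1) * p (n - 1))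
    (hpodd : ∀ n : ℕ, 1 ≤ n →
      p (2 * n + 1) = (X 0 + X 1) * p n + X 0 * X 2 * p (n - 1)) :
    ∀ m n : ℕ, 1 ≤ m → 1 ≤ n → m ∣ n →
      (MvPolynomial.aeval ![Polynomial.X, 1, 1] (p (2 ^ m - 2)) : Polynomial ℤ) ∣
        (MvPolynomial.aeval ![Polynomial.X, 1, 1] (p (2 ^ n - 2)) : Polynomial ℤ) := by
  rintro m n hm hn ⟨k, rfl⟩
  obtain ⟨m, rfl⟩ := Nat.exists_eq_add_of_le' hm
  obtain ⟨k, rfl⟩ := Nat.exists_eq_add_of_le' (Nat.pos_of_mul_pos_left hn)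
  have two_le_pow (j : ℕ) : 2 ≤ 2 ^ (j + 1) := Nat.le_self_pow j.succ_ne_zero 2
  have pow_eq (j : ℕ) : 2 ^ (j + 1 + 1) = 2 * 2 ^ (j + 1) := pow_succ' 2 (j + 1)
  have h := coupled_recurrence_dvd (c := Polynomial.X + 1) (d := Polynomial.X)
    (a := fun j => aeval ![(Polynomial.X : Polynomial ℤ), 1, 1] (p (2 ^ (j + 1) - 2)))
    (b := fun j => aeval ![(Polynomial.X : Polynomial ℤ), 1, 1] (p (2 ^ (j + 1) - 1)))
    (by simp [hp0]) (by simp [hp1])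
    (fun j => by
      have hj := two_le_pow j
      have hidx : 2 ^ (j + 1 + 1) - 2 = 2 * (2 ^ (j + 1) - 1) := by rw [pow_eq]; omega
      rw [hidx, hpeven _ (by omega), Nat.sub_sub]
      simp [add_comm])
    (fun j => by
      have hj := two_le_pow j
      have hidx : 2 ^ (j + 1 + 1) - 1 = 2 * (2 ^ (j + 1) - 1) + 1 := by rw [pow_eq]; omega
      rw [hidx, hpodd _ (by omega), Nat.sub_sub]
      simp)
    m k
  rwa [show (m + 1) * (k + 1) = (m + 1) * k + m + 1 by ring]
end

section
/- For every integer n ≥ 1, the identity X·Qx_{n−1}(X²) + Rx_n(X²) = (1 + X + X²)^n holds in ℤ[X], where Qx_{n−1}(X²) and Rx_n(X²) denote composition with X². -/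
open MvPolynomial

/-- Proposition 4.3: for n ≥ 1, `X·Qx (n-1) (X²) + Rx n (X²) = (1+X+X²)^n` in ℤ[X],
where `Qx (n-1)` corresponds to `p (2^n - 2)` and `Rx n` to `p (2^n - 1)` with
y = z = 1 substituted. -/
theorem binary_overpartition_trinomial_identity
    (p : ℕ → MvPolynomial (Fin 3) ℤ)
    (hp0 : p 0 = 1)
    (hp1 : p 1 = X 0 + X 1)
    (hpeven : ∀ n : ℕ, 1 ≤ n →
      p (2 * n) = p n + (X 2 + X 0 * X 1) * p (n - 1))
    (hpodd : ∀ n : ℕ, 1 ≤ n →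
      p (2 * n + 1) = (X 0 + X 1) * p n + X 0 * X 2 * p (n - 1)) :
    ∀ n : ℕ, 1 ≤ n →
      Polynomial.X *
          (MvPolynomial.aeval ![Polynomial.X, 1, 1] (p (2 ^ n - 2)) :
            Polynomial ℤ).comp (Polynomial.X ^ 2) +
        (MvPolynomial.aeval ![Polynomial.X, 1, 1] (p (2 ^ n - 1)) :
          Polynomial ℤ).comp (Polynomial.X ^ 2) =
      (1 + Polynomial.X + Polynomial.X ^ 2) ^ n := by
  intro n hn
  induction n, hn using Nat.le_induction with
  | base => simp [hp0, hp1]; ring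
  | succ n hn ih =>
    have hlt : 2 ≤ 2 ^ n := by simpa using Nat.pow_le_pow_right two_pos hn
    have he : 2 ^ (n + 1) - 2 = 2 * (2 ^ n - 1) := by rw [pow_succ]; omega
    have ho : 2 ^ (n + 1) - 1 = 2 * (2 ^ n - 1) + 1 := by rw [pow_succ]; omega
    have hs : 2 ^ n - 1 - 1 = 2 ^ n - 2 := by omega
    rw [he, ho, hpeven _ (by omega), hpodd _ (by omega), hs, pow_succ _ n, ← ih]
    simp
    ring
end

section
/- For every integer n ≥ 1 and every j ≥ 0, the coefficient of x^j in Rx_n equals the coefficient of x^{2j} in (1 + x + x²)^n, and the coefficient of x^j in Qx_{n−1} equals the coefficient of x^{2j+1} in (1 + x + x²)^n; that is, the coefficients of Rx_n are the even-index trinomial coefficients of order n and the coefficients of Qx_{n−1} are the odd-index trinomial coefficients of order n. -/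
open MvPolynomial

/-- The coefficients of `f(x²) + x g(x²)` are those of `f` at even indices and those of `g`
at odd ones. -/
theorem Polynomial.coeff_expand_two_add_X_mul_expand_two {R : Type*} [CommSemiring R]
    (f g : Polynomial R) (j : ℕ) :
    (Polynomial.expand R 2 f + Polynomial.X * Polynomial.expand R 2 g).coeff (2 * j) = f.coeff j ∧
    (Polynomial.expand R 2 f + Polynomial.X * Polynomial.expand R 2 g).coeff (2 * j + 1) =
      g.coeff j := by
  constructor
  · cases j with
    | zero => simp [Polynomial.coeff_expand]
    | succ k =>
      have h : ¬ 2 ∣ 2 * k + 1 := by omega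
      rw [show 2 * (k + 1) = 2 * k + 1 + 1 by ring, Polynomial.coeff_add, Polynomial.coeff_X_mul,
        Polynomial.coeff_expand two_pos, Polynomial.coeff_expand two_pos, if_neg h, add_zero,
        if_pos (by omega)]
      congr 1
      omega
  · have h : ¬ 2 ∣ 2 * j + 1 := by omega
    rw [Polynomial.coeff_add, Polynomial.coeff_X_mul, Polynomial.coeff_expand two_pos, if_neg h,
      zero_add, mul_comm 2 j, Polynomial.coeff_expand_mul two_pos]

/-- Identity (4.10): the coefficients of `Rx n` are the even-index trinomial
coefficients of order n, and those of `Qx (n-1)` are the odd-index ones. -/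
theorem binary_overpartition_trinomial_coefficients
    (p : ℕ → MvPolynomial (Fin 3) ℤ)
    (hp0 : p 0 = 1)
    (hp1 : p 1 = X 0 + X 1)
    (hpeven : ∀ n : ℕ, 1 ≤ n →
      p (2 * n) = p n + (X 2 + X 0 * X 1) * p (n - 1))
    (hpodd : ∀ n : ℕ, 1 ≤ n →
      p (2 * n + 1) = (X 0 + X 1) * p n + X 0 * X 2 * p (n - 1)) :
    ∀ n : ℕ, 1 ≤ n → ∀ j : ℕ,
      (MvPolynomial.aeval ![Polynomial.X, 1, 1] (p (2 ^ n - 1)) :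
          Polynomial ℤ).coeff j =
        (((1 + Polynomial.X + Polynomial.X ^ 2) ^ n : Polynomial ℤ)).coeff (2 * j) ∧
      (MvPolynomial.aeval ![Polynomial.X, 1, 1] (p (2 ^ n - 2)) :
          Polynomial ℤ).coeff j =
        (((1 + Polynomial.X + Polynomial.X ^ 2) ^ n : Polynomial ℤ)).coeff (2 * j + 1) := by
  intro n hn j
  suffices key : ((1 + Polynomial.X + Polynomial.X ^ 2) ^ n : Polynomial ℤ) =
      Polynomial.expand ℤ 2 (MvPolynomial.aeval ![Polynomial.X, 1, 1] (p (2 ^ n - 1))) +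
      Polynomial.X *
        Polynomial.expand ℤ 2 (MvPolynomial.aeval ![Polynomial.X, 1, 1] (p (2 ^ n - 2))) by
    rw [key]
    obtain ⟨heven, hodd⟩ := Polynomial.coeff_expand_two_add_X_mul_expand_two
      (MvPolynomial.aeval ![Polynomial.X, 1, 1] (p (2 ^ n - 1)) : Polynomial ℤ)
      (MvPolynomial.aeval ![Polynomial.X, 1, 1] (p (2 ^ n - 2))) j
    exact ⟨heven.symm, hodd.symm⟩
  clear j
  induction n, hn using Nat.le_induction with
  | base =>
    simp [hp0, hp1]
    ring
  | succ n hn ih =>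
    have hpow : 2 ≤ 2 ^ n := Nat.le_self_pow (by omega) 2
    have hR := hpodd (2 ^ n - 1) (by omega)
    have hQ := hpeven (2 ^ n - 1) (by omega)
    rw [show 2 ^ n - 1 - 1 = 2 ^ n - 2 by omega] at hR hQ
    rw [show 2 * (2 ^ n - 1) + 1 = 2 ^ (n + 1) - 1 by rw [pow_succ]; omega] at hR
    rw [show 2 * (2 ^ n - 1) = 2 ^ (n + 1) - 2 by rw [pow_succ]; omega] at hQ
    rw [pow_succ, ih, hR, hQ]
    simp only [map_add, map_mul, MvPolynomial.aeval_X, Matrix.cons_val, Polynomial.expand_X,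
      map_one]
    ring
end

section
/- For every n ≥ 1, the polynomial g_n = Q_n(z,z,z) ∈ ℤ[z] satisfies: (a) g_n is monic of degree 2n and its coefficient of z^j vanishes for all j < n; (b) the coefficient of z^{2n−1} in g_n equals n + 2; (c) the coefficient of z^n in g_n equals the Fibonacci number F_{2n+2} (with F_1 = F_2 = 1). -/
open MvPolynomial

/-- The coefficients of `R (n + 1)` and `Q n` at `(z, z, z)` that the recursion determines. -/
def CoeffShape (n : ℕ) (r q : Polynomial ℤ) : Prop :=
  (∀ j, j < n + 1 ∨ 2 * n < j → r.coeff j = 0) ∧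
  r.coeff (n + 1) = Nat.fib (2 * n + 3) ∧
  (∀ j, j < n ∨ 2 * n < j → q.coeff j = 0) ∧
  q.coeff (2 * n) = 1 ∧
  q.coeff (2 * n - 1) = n + 2 ∧
  q.coeff n = Nat.fib (2 * n + 2)

lemma coeffShape_one :
    CoeffShape 1 (5 * Polynomial.X ^ 2) (3 * Polynomial.X + Polynomial.X ^ 2) := by
  have h5 (j : ℕ) : (5 * Polynomial.X ^ 2 : Polynomial ℤ).coeff j = if j = 2 then 5 else 0 := by
    simp [Polynomial.coeff_X_pow]
  have h3 (j : ℕ) : (3 * Polynomial.X : Polynomial ℤ).coeff j = if j = 1 then 3 else 0 := by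
    simpa using Polynomial.coeff_C_mul_X (3 : ℤ) j
  refine ⟨fun j hj => ?_, ?_, fun j hj => ?_, ?_, ?_, ?_⟩
  · rw [h5, if_neg (by lia)]
  · simp [h5, Nat.fib_add_two]
  · rw [Polynomial.coeff_add, h3, Polynomial.coeff_X_pow, if_neg (by lia), if_neg (by lia),
      add_zero]
  all_goals simp [h3, Polynomial.coeff_X_pow, Nat.fib_add_two]

lemma CoeffShape.succ {n : ℕ} (hn : 1 ≤ n) {r q : Polynomial ℤ} (h : CoeffShape n r q) :
    CoeffShape (n + 1) (2 * Polynomial.X * r + Polynomial.X ^ 2 * q)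
      (r + (Polynomial.X + Polynomial.X ^ 2) * q) := by
  obtain ⟨hr, hrlow, hq, hqtop, hqnext, hqlow⟩ := h
  have hr' (j : ℕ) : (2 * Polynomial.X * r + Polynomial.X ^ 2 * q).coeff (j + 2) =
      2 * r.coeff (j + 1) + q.coeff j := by
    rw [show 2 * Polynomial.X * r + Polynomial.X ^ 2 * q =
      Polynomial.X * r + Polynomial.X * r + Polynomial.X ^ 2 * q by ring]
    simp only [Polynomial.coeff_add, Polynomial.coeff_X_mul, Polynomial.coeff_X_pow_mul]
    ring
  have hq' (j : ℕ) : (r + (Polynomial.X + Polynomial.X ^ 2) * q).coeff (j + 2) =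
      r.coeff (j + 2) + q.coeff (j + 1) + q.coeff j := by
    simp only [add_mul, Polynomial.coeff_add, Polynomial.coeff_X_mul, Polynomial.coeff_X_pow_mul]
    ring
  have hr0 : r.coeff 0 = 0 := hr 0 (by lia)
  have hr1 : r.coeff 1 = 0 := hr 1 (by lia)
  have hq0 : q.coeff 0 = 0 := hq 0 (by lia)
  refine ⟨fun j hj => ?_, ?_, fun j hj => ?_, ?_, ?_, ?_⟩
  · match j with
    | 0 => simp [Polynomial.mul_coeff_zero]
    | 1 =>
      rw [show 2 * Polynomial.X * r + Polynomial.X ^ 2 * q =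
        Polynomial.X * (r + r + Polynomial.X * q) by ring, Polynomial.coeff_X_mul]
      simp [hr0]
    | j + 2 => rw [hr', hr _ (by lia), hq _ (by lia)]; rfl
  · have h₄ : Nat.fib (2 * n + 4) = Nat.fib (2 * n + 2) + Nat.fib (2 * n + 3) := Nat.fib_add_two
    have h₅ : Nat.fib (2 * (n + 1) + 3) = Nat.fib (2 * n + 3) + Nat.fib (2 * n + 4) :=
      Nat.fib_add_two
    rw [hr', hrlow, hqlow]
    lia
  · match j with
    | 0 => simp [Polynomial.mul_coeff_zero, hr0]
    | 1 =>
      rw [show r + (Polynomial.X + Polynomial.X ^ 2) * q =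
        r + Polynomial.X * (q + Polynomial.X * q) by ring, Polynomial.coeff_add,
        Polynomial.coeff_X_mul]
      simp [hr1, hq0]
    | j + 2 => rw [hq', hr _ (by lia), hq _ (by lia), hq _ (by lia)]; rfl
  · rw [show 2 * (n + 1) = 2 * n + 2 by ring, hq', hr _ (by lia), hq (2 * n + 1) (by lia), hqtop]
    rfl
  · rw [show 2 * (n + 1) - 1 = 2 * n - 1 + 2 by lia, hq', hr _ (by lia),
      show 2 * n - 1 + 1 = 2 * n by lia, hqtop, hqnext]
    push_cast
    ring
  · obtain ⟨m, rfl⟩ : ∃ m, n = m + 1 := ⟨n - 1, by lia⟩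
    have h₄ : Nat.fib (2 * (m + 1 + 1) + 2) =
        Nat.fib (2 * (m + 1) + 2) + Nat.fib (2 * (m + 1) + 3) := Nat.fib_add_two
    rw [hq', hrlow, hqlow, hq m (by lia)]
    lia

lemma coeffShape_of_recurrence (p : ℕ → Polynomial ℤ) (hp0 : p 0 = 1)
    (hp1 : p 1 = Polynomial.X + Polynomial.X)
    (hpeven : ∀ n : ℕ, 1 ≤ n →
      p (2 * n) = p n + (Polynomial.X + Polynomial.X * Polynomial.X) * p (n - 1))
    (hpodd : ∀ n : ℕ, 1 ≤ n →
      p (2 * n + 1) =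
        (Polynomial.X + Polynomial.X) * p n + Polynomial.X * Polynomial.X * p (n - 1))
    {n : ℕ} (hn : 1 ≤ n) : CoeffShape n (p (2 ^ (n + 1) - 1)) (p (2 ^ (n + 1) - 2)) := by
  induction n, hn using Nat.le_induction with
  | base =>
    have hp2 : p 2 = 3 * Polynomial.X + Polynomial.X ^ 2 := by
      rw [hpeven 1 le_rfl, hp1, hp0]
      ring
    have hp3 : p 3 = 5 * Polynomial.X ^ 2 := by
      rw [hpodd 1 le_rfl, hp1, hp0]
      ring
    simpa [hp2, hp3] using coeffShape_one
  | succ n hn ih =>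
    have hpow : 2 ≤ 2 ^ (n + 1) := by
      have := Nat.one_le_two_pow (n := n)
      lia
    have hsub : 2 ^ (n + 1) - 1 - 1 = 2 ^ (n + 1) - 2 := by lia
    have hodd := hpodd (2 ^ (n + 1) - 1) (by lia)
    have heven := hpeven (2 ^ (n + 1) - 1) (by lia)
    rw [show 2 * (2 ^ (n + 1) - 1) + 1 = 2 ^ (n + 1 + 1) - 1 by lia, hsub] at hodd
    rw [show 2 * (2 ^ (n + 1) - 1) = 2 ^ (n + 1 + 1) - 2 by lia, hsub] at heven
    rw [hodd, heven, ← two_mul, ← sq]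
    exact ih.succ hn

/-- Lemma 9.2 (a)-(c): for n ≥ 1, the polynomial `g n = Q n (z,z,z) ∈ ℤ[z]` is monic of
degree 2n with lowest term of degree n; the coefficient of z^(2n-1) is n+2; and the
coefficient of z^n is the Fibonacci number F_(2n+2). -/
theorem binary_overpartition_Qzzz_coefficients
    (p : ℕ → MvPolynomial (Fin 3) ℤ)
    (hp0 : p 0 = 1)
    (hp1 : p 1 = X 0 + X 1)
    (hpeven : ∀ n : ℕ, 1 ≤ n →
      p (2 * n) = p n + (X 2 + X 0 * X 1) * p (n - 1))
    (hpodd : ∀ n : ℕ, 1 ≤ n →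
      p (2 * n + 1) = (X 0 + X 1) * p n + X 0 * X 2 * p (n - 1)) :
    ∀ n : ℕ, 1 ≤ n →
      (MvPolynomial.aeval (fun _ => Polynomial.X) (p (2 ^ (n + 1) - 2)) :
          Polynomial ℤ).Monic ∧
      (MvPolynomial.aeval (fun _ => Polynomial.X) (p (2 ^ (n + 1) - 2)) :
          Polynomial ℤ).natDegree = 2 * n ∧
      (∀ j : ℕ, j < n →
        (MvPolynomial.aeval (fun _ => Polynomial.X) (p (2 ^ (n + 1) - 2)) :
            Polynomial ℤ).coeff j = 0) ∧
      (MvPolynomial.aeval (fun _ => Polynomial.X) (p (2 ^ (n + 1) - 2)) :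
          Polynomial ℤ).coeff (2 * n - 1) = (n : ℤ) + 2 ∧
      (MvPolynomial.aeval (fun _ => Polynomial.X) (p (2 ^ (n + 1) - 2)) :
          Polynomial ℤ).coeff n = (Nat.fib (2 * n + 2) : ℤ) := by
  intro n hn
  obtain ⟨-, -, hq, htop, hnext, hlow⟩ := coeffShape_of_recurrence
    (fun k => MvPolynomial.aeval (fun _ => Polynomial.X) (p k)) (by simp [hp0]) (by simp [hp1])
    (fun k hk => by simp [hpeven k hk]) (fun k hk => by simp [hpodd k hk]) hn
  have hdeg := Polynomial.natDegree_eq_of_le_of_coeff_ne_zero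
    (Polynomial.natDegree_le_iff_coeff_eq_zero.2 fun j hj => hq j (.inr hj))
    (htop.trans_ne one_ne_zero)
  refine ⟨?_, hdeg, fun j hj => hq j (.inl hj), hnext, hlow⟩
  rw [Polynomial.Monic, Polynomial.leadingCoeff, hdeg]
  exact htop
end

section
/- For every n ≥ 3, the polynomial h_n = R_n(z,z,z) ∈ ℤ[z] satisfies: (a) h_n is monic of degree 2n − 2 and its coefficient of z^j vanishes for all j < n; (b) for n ≥ 4, the coefficient of z^{2n−3} in h_n equals n + 2; (c) the coefficient of z^n in h_n equals the Fibonacci number F_{2n+1} (with F_1 = F_2 = 1). -/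
open MvPolynomial

/-- The recurrences for `r n = p (2 ^ n - 1)` and `q n = p (2 ^ n - 2)` specialised at
`x = y = z`, solved up to powers of the variable: the cofactors of `X ^ n` and `X ^ (n - 1)`
have known degree, leading coefficients and constant term. -/
theorem exists_cofactors_of_recurrence (r q : ℕ → Polynomial ℤ)
    (hr1 : r 1 = 2 * Polynomial.X) (hq1 : q 1 = 1)
    (hr : ∀ n, 1 ≤ n → r (n + 1) = 2 * Polynomial.X * r n + Polynomial.X ^ 2 * q n)
    (hq : ∀ n, 1 ≤ n → q (n + 1) = r n + (Polynomial.X + Polynomial.X ^ 2) * q n) (m : ℕ) :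
    ∃ a b : Polynomial ℤ,
      r (m + 3) = a * Polynomial.X ^ (m + 3) ∧ q (m + 3) = b * Polynomial.X ^ (m + 2) ∧
      a.natDegree ≤ m + 1 ∧ a.coeff (m + 1) = 1 ∧ (1 ≤ m → a.coeff m = m + 5) ∧
      a.coeff 0 = Nat.fib (2 * m + 7) ∧
      b.natDegree ≤ m + 2 ∧ b.coeff (m + 2) = 1 ∧ b.coeff (m + 1) = m + 4 ∧
      b.coeff 0 = Nat.fib (2 * m + 6) := by
  induction m with
  | zero =>
    have hr2 := hr 1 le_rfl
    have hq2 := hq 1 le_rfl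
    have hr3 := hr 2 one_le_two
    have hq3 := hq 2 one_le_two
    norm_num only [hr1, hq1] at hr2 hq2
    norm_num only [hr2, hq2] at hr3 hq3
    refine ⟨.C 13 + .X, .C 8 + .C 4 * .X + .X ^ 2, ?_, ?_, ?_, ?_, by simp, ?_, ?_, ?_, ?_, ?_⟩
    · simp only [Nat.zero_add, hr3, map_ofNat]
      ring
    · simp only [Nat.zero_add, hq3, map_ofNat]
      ring
    · compute_degree
    · simp [Polynomial.coeff_X]
    · simp [Nat.fib_add_two]
    · compute_degree
    · simp [Polynomial.coeff_X]
    · simp [Polynomial.coeff_X, Polynomial.coeff_X_pow]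
    · simp [Nat.fib_add_two]
  | succ m ih =>
    obtain ⟨a, b, hra, hqb, hda, ha1, -, ha0, hdb, hb2, hb1, hb0⟩ := ih
    have ha2 : a.coeff (m + 2) = 0 := Polynomial.coeff_eq_zero_of_natDegree_lt (by omega)
    have ha3 : a.coeff (m + 3) = 0 := Polynomial.coeff_eq_zero_of_natDegree_lt (by omega)
    have hb3 : b.coeff (m + 3) = 0 := Polynomial.coeff_eq_zero_of_natDegree_lt (by omega)
    have fib_succ (k : ℕ) : (Nat.fib (k + 2) : ℤ) = Nat.fib k + Nat.fib (k + 1) := by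
      exact_mod_cast Nat.fib_add_two
    have f8 := fib_succ (2 * m + 6)
    have f9 := fib_succ (2 * m + 7)
    refine ⟨.C 2 * a + b, a + b + b * .X, ?_, ?_, ?_, ?_, fun _ ↦ ?_, ?_, ?_, ?_, ?_, ?_⟩
    · rw [show m + 1 + 3 = m + 3 + 1 by ring, hr _ (by omega), hra, hqb, map_ofNat]
      ring
    · rw [show m + 1 + 3 = m + 3 + 1 by ring, hq _ (by omega), hra, hqb]
      ring
    · compute_degree
      omega
    · simp [ha2, hb2]
    · rw [Polynomial.coeff_add, Polynomial.coeff_C_mul, ha1, hb1]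
      push_cast
      ring
    · rw [Polynomial.coeff_add, Polynomial.coeff_C_mul, ha0, hb0,
        show 2 * (m + 1) + 7 = 2 * m + 7 + 2 by ring]
      linarith
    · compute_degree
      omega
    · rw [show m + 1 + 2 = m + 2 + 1 by ring, Polynomial.coeff_add, Polynomial.coeff_add,
        Polynomial.coeff_mul_X, ha3, hb3, hb2]
      rfl
    · simp only [Polynomial.coeff_add, Polynomial.coeff_mul_X, hb1]
      rw [ha2, hb2]
      push_cast
      ring
    · rw [Polynomial.coeff_add, Polynomial.coeff_add, Polynomial.coeff_mul_X_zero, ha0, hb0,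
        show 2 * (m + 1) + 6 = 2 * m + 6 + 2 by ring]
      linarith

/-- Lemma 9.2 (d)-(f): for n ≥ 3, the polynomial `h n = R n (z,z,z) ∈ ℤ[z]` is monic of
degree 2n-2 with lowest term of degree n; for n ≥ 4 the coefficient of z^(2n-3) is n+2;
and the coefficient of z^n is the Fibonacci number F_(2n+1). -/
theorem binary_overpartition_Rzzz_coefficients
    (p : ℕ → MvPolynomial (Fin 3) ℤ)
    (hp0 : p 0 = 1)
    (hp1 : p 1 = X 0 + X 1)
    (hpeven : ∀ n : ℕ, 1 ≤ n →
      p (2 * n) = p n + (X 2 + X 0 * X 1) * p (n - 1))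
    (hpodd : ∀ n : ℕ, 1 ≤ n →
      p (2 * n + 1) = (X 0 + X 1) * p n + X 0 * X 2 * p (n - 1)) :
    ∀ n : ℕ, 3 ≤ n →
      (MvPolynomial.aeval (fun _ => Polynomial.X) (p (2 ^ n - 1)) :
          Polynomial ℤ).Monic ∧
      (MvPolynomial.aeval (fun _ => Polynomial.X) (p (2 ^ n - 1)) :
          Polynomial ℤ).natDegree = 2 * n - 2 ∧
      (∀ j : ℕ, j < n →
        (MvPolynomial.aeval (fun _ => Polynomial.X) (p (2 ^ n - 1)) :
            Polynomial ℤ).coeff j = 0) ∧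
      (4 ≤ n →
        (MvPolynomial.aeval (fun _ => Polynomial.X) (p (2 ^ n - 1)) :
            Polynomial ℤ).coeff (2 * n - 3) = (n : ℤ) + 2) ∧
      (MvPolynomial.aeval (fun _ => Polynomial.X) (p (2 ^ n - 1)) :
          Polynomial ℤ).coeff n = (Nat.fib (2 * n + 1) : ℤ) := by
  intro n hn
  obtain ⟨m, rfl⟩ := Nat.exists_eq_add_of_le' hn
  set φ : MvPolynomial (Fin 3) ℤ →ₐ[ℤ] Polynomial ℤ :=
    MvPolynomial.aeval (fun _ => Polynomial.X) with hφ
  have hpos (k : ℕ) (hk : 1 ≤ k) : 1 ≤ 2 ^ k - 1 := by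
    have := Nat.pow_le_pow_right two_pos hk
    omega
  obtain ⟨a, b, hra, -, hda, ha1, ha, ha0, -⟩ := exists_cofactors_of_recurrence
    (fun k ↦ φ (p (2 ^ k - 1))) (fun k ↦ φ (p (2 ^ k - 2)))
    (by simp [hp1, hφ, two_mul]) (by simp [hp0])
    (fun k hk ↦ by
      have := hpos k hk
      rw [show 2 ^ (k + 1) - 1 = 2 * (2 ^ k - 1) + 1 by omega, hpodd _ this]
      simp only [hφ, map_add, map_mul, aeval_X, Nat.sub_sub]
      ring)
    (fun k hk ↦ by
      have := hpos k hk
      rw [show 2 ^ (k + 1) - 2 = 2 * (2 ^ k - 1) by omega, hpeven _ this]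
      simp only [hφ, map_add, map_mul, aeval_X, Nat.sub_sub]
      ring) m
  have hdeg : a.natDegree = m + 1 :=
    Polynomial.natDegree_eq_of_le_of_coeff_ne_zero hda (by simp [ha1])
  have hmonic : a.Monic := by rw [Polynomial.Monic, Polynomial.leadingCoeff, hdeg, ha1]
  simp only [hra]
  refine ⟨hmonic.mul (Polynomial.monic_X_pow _), ?_, fun j hj ↦ ?_, fun h4 ↦ ?_, ?_⟩
  · rw [hmonic.natDegree_mul (Polynomial.monic_X_pow _), hdeg, Polynomial.natDegree_X_pow]
    omega
  · rw [Polynomial.coeff_mul_X_pow', if_neg (by omega)]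
  · rw [show 2 * (m + 3) - 3 = m + (m + 3) by omega, Polynomial.coeff_mul_X_pow,
      ha (by omega)]
    push_cast
    ring
  · rw [Polynomial.coeff_mul_X_pow', if_pos le_rfl, Nat.sub_self, ha0,
      show 2 * (m + 3) + 1 = 2 * m + 7 by ring]
end

section
/- For every n ≥ 0, the identity (z + 1)·Q_n(1,y,z) = (y + z + 1)^{n+1} − y^{n+1} holds in ℤ[y,z]. -/
open MvPolynomial

/-- Proposition 5.1: `(z+1)·Q n (1,y,z) = (y+z+1)^(n+1) - y^(n+1)` in ℤ[y,z],
where in `MvPolynomial (Fin 2) ℤ` the variable `X 0` plays the role of y and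
`X 1` that of z. -/
theorem binary_overpartition_Q_one_y_z
    (p : ℕ → MvPolynomial (Fin 3) ℤ)
    (hp0 : p 0 = 1)
    (hp1 : p 1 = X 0 + X 1)
    (hpeven : ∀ n : ℕ, 1 ≤ n →
      p (2 * n) = p n + (X 2 + X 0 * X 1) * p (n - 1))
    (hpodd : ∀ n : ℕ, 1 ≤ n →
      p (2 * n + 1) = (X 0 + X 1) * p n + X 0 * X 2 * p (n - 1)) :
    ∀ n : ℕ,
      (X 1 + 1) *
          (MvPolynomial.aeval ![1, X 0, X 1] (p (2 ^ (n + 1) - 2)) :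
            MvPolynomial (Fin 2) ℤ) =
        (X 0 + X 1 + 1) ^ (n + 1) - X 0 ^ (n + 1) := by
  set q : ℕ → MvPolynomial (Fin 2) ℤ := fun k => aeval ![1, X 0, X 1] (p k) with hq
  have hq0 : q 0 = 1 := by simp [hq, hp0]
  have hq1 : q 1 = 1 + X 0 := by simp [hq, hp1]
  have hqeven (m : ℕ) : q (2 * (m + 1)) = q (m + 1) + (X 1 + X 0) * q m := by
    simp [hq, hpeven (m + 1)]
  have hqodd (m : ℕ) : q (2 * (m + 1) + 1) = (1 + X 0) * q (m + 1) + X 1 * q m := by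
    simp [hq, hpodd (m + 1)]
  have hsucc (n : ℕ) : 2 ^ (n + 2) - 2 = 2 * ((2 ^ (n + 1) - 2) + 1) := by
    have := Nat.one_le_two_pow (n := n)
    lia
  suffices h : ∀ n : ℕ,
      (X 1 + 1) * q (2 ^ (n + 1) - 2) = (X 0 + X 1 + 1) ^ (n + 1) - X 0 ^ (n + 1) ∧
      (X 1 + 1) * q (2 ^ (n + 1) - 2 + 1) = (X 0 + X 1 + 1) ^ (n + 1) + X 1 * X 0 ^ (n + 1) from
    fun n => (h n).1
  intro n
  induction n with
  | zero =>
    simp only [zero_add, pow_one, Nat.sub_self, hq0, hq1]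
    constructor <;> ring
  | succ n ih =>
    obtain ⟨hQ, hR⟩ := ih
    rw [hsucc, hqeven, hqodd]
    constructor
    · linear_combination hR + (X 1 + X 0) * hQ
    · linear_combination (1 + X 0) * hR + X 1 * hQ
end

section
/- For every n ≥ 1, the polynomial f_n = Q_n(1,z,z²) ∈ ℤ[z] is a monic self-reciprocal polynomial of degree 2n (i.e., for all 0 ≤ j ≤ 2n the coefficient of z^j equals the coefficient of z^{2n−j}), and the sum of its coefficients is f_n(1) = (3^{n+1} − 1)/2. -/
open MvPolynomial

namespace Polynomial

/-- `f` is self-reciprocal when regarded as a polynomial of degree `d`. -/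
def IsPalindromic (d : ℕ) (f : ℤ[X]) : Prop :=
  f.natDegree ≤ d ∧ f.reflect d = f

namespace IsPalindromic

variable {d e : ℕ} {f g : ℤ[X]}

theorem mul (hf : IsPalindromic d f) (hg : IsPalindromic e g) :
    IsPalindromic (d + e) (f * g) :=
  ⟨natDegree_mul_le_of_le hf.1 hg.1, by rw [reflect_mul f g hf.1 hg.1, hf.2, hg.2]⟩

theorem sub (hf : IsPalindromic d f) (hg : IsPalindromic d g) : IsPalindromic d (f - g) :=
  ⟨(natDegree_sub_le_of_le hf.1 hg.1).trans (max_self d).le,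
    by rw [reflect_sub, hf.2, hg.2]⟩

theorem coeff_eq (hf : IsPalindromic d f) {j : ℕ} (hj : j ≤ d) :
    f.coeff j = f.coeff (d - j) := by
  conv_lhs => rw [← hf.2]
  rw [coeff_reflect, revAt_le hj]

theorem coeff_eq_one (hf : IsPalindromic d f) (h0 : f.coeff 0 = 1) : f.coeff d = 1 := by
  simpa [h0] using hf.coeff_eq le_rfl

theorem monic (hf : IsPalindromic d f) (h0 : f.coeff 0 = 1) : f.Monic :=
  monic_of_natDegree_le_of_coeff_eq_one d hf.1 (hf.coeff_eq_one h0)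

theorem natDegree_eq (hf : IsPalindromic d f) (h0 : f.coeff 0 = 1) : f.natDegree = d :=
  le_antisymm hf.1 (le_natDegree_of_ne_zero (by simp [hf.coeff_eq_one h0]))

end IsPalindromic

theorem isPalindromic_one : IsPalindromic 0 1 := by
  simp [IsPalindromic]

theorem isPalindromic_one_add_X : IsPalindromic 1 (1 + X) := by
  refine ⟨by compute_degree, ?_⟩
  rw [reflect_add, reflect_one, ← pow_one (X : ℤ[X]), reflect_monomial, revAt_le le_rfl]
  ring

theorem isPalindromic_one_add_X_sq : IsPalindromic 2 ((1 + X) ^ 2) := by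
  rw [sq]
  exact isPalindromic_one_add_X.mul isPalindromic_one_add_X

theorem isPalindromic_X : IsPalindromic 2 X := by
  refine ⟨natDegree_X_le.trans one_le_two, ?_⟩
  conv_lhs => rw [← pow_one (X : ℤ[X]), reflect_monomial, revAt_le one_le_two]
  exact pow_one X

theorem isPalindromic_X_mul_one_add_X_add_X_sq : IsPalindromic 4 (X * (1 + X + X ^ 2)) := by
  have h : (X * (1 + X + X ^ 2) : ℤ[X]) = X * ((1 + X) ^ 2 - X) := by ring
  rw [h]
  exact isPalindromic_X.mul (isPalindromic_one_add_X_sq.sub isPalindromic_X)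

theorem isPalindromic_of_recurrence
    {f : ℕ → ℤ[X]} (h0 : f 0 = 1) (h1 : f 1 = (1 + X) ^ 2)
    (hrec : ∀ n, f (n + 2) = (1 + X) ^ 2 * f (n + 1) - X * (1 + X + X ^ 2) * f n)
    (n : ℕ) :
    IsPalindromic (2 * n) (f n) := by
  induction n using Nat.twoStepInduction with
  | zero => simpa [h0] using isPalindromic_one
  | one => simpa [h1] using isPalindromic_one_add_X_sq
  | more n ih ih' =>
    have h := isPalindromic_one_add_X_sq.mul ih'
    have h' := isPalindromic_X_mul_one_add_X_add_X_sq.mul ih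
    rw [show 2 + 2 * (n + 1) = 2 * (n + 2) by ring] at h
    rw [show 4 + 2 * n = 2 * (n + 2) by ring] at h'
    rw [hrec]
    exact h.sub h'

theorem coeff_zero_of_recurrence
    {f : ℕ → ℤ[X]} (h0 : f 0 = 1) (h1 : f 1 = (1 + X) ^ 2)
    (hrec : ∀ n, f (n + 2) = (1 + X) ^ 2 * f (n + 1) - X * (1 + X + X ^ 2) * f n)
    (n : ℕ) :
    (f n).coeff 0 = 1 := by
  induction n using Nat.twoStepInduction with
  | zero => simp [h0]
  | one => simp [h1, coeff_zero_eq_eval_zero]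
  | more n _ ih' =>
    rw [coeff_zero_eq_eval_zero] at ih' ⊢
    simp [hrec, ih']

theorem two_mul_eval_one_of_recurrence
    {f : ℕ → ℤ[X]} (h0 : f 0 = 1) (h1 : f 1 = (1 + X) ^ 2)
    (hrec : ∀ n, f (n + 2) = (1 + X) ^ 2 * f (n + 1) - X * (1 + X + X ^ 2) * f n)
    (n : ℕ) :
    2 * (f n).eval 1 = 3 ^ (n + 1) - 1 := by
  induction n using Nat.twoStepInduction with
  | zero => simp [h0]
  | one => norm_num [h1]
  | more n ih ih' =>
    simp only [hrec, eval_sub, eval_mul, eval_add, eval_pow, eval_one, eval_X]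
    linear_combination 4 * ih' - 3 * ih

end Polynomial

/-- Corollary 5.5: for n ≥ 1, `f n = Q n (1,z,z²) ∈ ℤ[z]` is monic, self-reciprocal of
degree 2n, and the sum of its coefficients is `f n (1) = (3^(n+1)-1)/2`. -/
theorem binary_overpartition_Q_one_z_zsq_self_reciprocal
    (p : ℕ → MvPolynomial (Fin 3) ℤ)
    (hp0 : p 0 = 1)
    (hp1 : p 1 = X 0 + X 1)
    (hpeven : ∀ n : ℕ, 1 ≤ n →
      p (2 * n) = p n + (X 2 + X 0 * X 1) * p (n - 1))
    (hpodd : ∀ n : ℕ, 1 ≤ n →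
      p (2 * n + 1) = (X 0 + X 1) * p n + X 0 * X 2 * p (n - 1)) :
    ∀ n : ℕ, 1 ≤ n →
      (MvPolynomial.aeval ![1, Polynomial.X, Polynomial.X ^ 2] (p (2 ^ (n + 1) - 2)) :
          Polynomial ℤ).Monic ∧
      (MvPolynomial.aeval ![1, Polynomial.X, Polynomial.X ^ 2] (p (2 ^ (n + 1) - 2)) :
          Polynomial ℤ).natDegree = 2 * n ∧
      (∀ j : ℕ, j ≤ 2 * n →
        (MvPolynomial.aeval ![1, Polynomial.X, Polynomial.X ^ 2] (p (2 ^ (n + 1) - 2)) :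
            Polynomial ℤ).coeff j =
          (MvPolynomial.aeval ![1, Polynomial.X, Polynomial.X ^ 2] (p (2 ^ (n + 1) - 2)) :
              Polynomial ℤ).coeff (2 * n - j)) ∧
      2 * Polynomial.eval 1
          (MvPolynomial.aeval ![1, Polynomial.X, Polynomial.X ^ 2] (p (2 ^ (n + 1) - 2)) :
            Polynomial ℤ) = 3 ^ (n + 1) - 1 := by
  set f : ℕ → Polynomial ℤ := fun n =>
    aeval ![1, Polynomial.X, Polynomial.X ^ 2] (p (2 ^ (n + 1) - 2)) with hf
  have h0 : f 0 = 1 := by simp [hf, hp0]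
  have h1 : f 1 = (1 + Polynomial.X) ^ 2 := by
    have h := hpeven 1 le_rfl
    simp only [mul_one, Nat.sub_self, hp0, hp1] at h
    simp [hf, h]
    ring
  have hrec (n : ℕ) : f (n + 2) = (1 + Polynomial.X) ^ 2 * f (n + 1) -
      Polynomial.X * (1 + Polynomial.X + Polynomial.X ^ 2) * f n := by
    obtain ⟨k, hk⟩ : ∃ k, 2 ^ (n + 1) = k + 2 :=
      Nat.exists_eq_add_of_le' (by rw [pow_succ]; have := Nat.one_le_two_pow (n := n); lia)
    have e₀ : 2 ^ (n + 1) - 2 = k := by lia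
    have e₁ : 2 ^ (n + 1 + 1) - 2 = 2 * (k + 1) := by rw [pow_succ]; lia
    have e₂ : 2 ^ (n + 2 + 1) - 2 = 2 * (2 * (k + 1) + 1) := by
      rw [show n + 2 + 1 = n + 1 + 1 + 1 by rfl, pow_succ, pow_succ]; lia
    simp only [hf, e₀, e₁, e₂]
    rw [hpeven (2 * (k + 1) + 1) (by lia), hpodd (k + 1) (by lia), Nat.add_sub_cancel,
      Nat.add_sub_cancel, hpeven (k + 1) (by lia), Nat.add_sub_cancel]
    simp
    ring
  intro n _
  have hpal := Polynomial.isPalindromic_of_recurrence h0 h1 hrec n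
  have hcoeff := Polynomial.coeff_zero_of_recurrence h0 h1 hrec n
  exact ⟨hpal.monic hcoeff, hpal.natDegree_eq hcoeff, fun _ hj => hpal.coeff_eq hj,
    Polynomial.two_mul_eval_one_of_recurrence h0 h1 hrec n⟩
end

section
/- For every n ≥ 1, the image of Q_n(1,z,z) in ℚ[z] admits the factorization Q_n(1,z,z) = ∏_{d ∣ n+1, d ≠ 1} G_d, where for each divisor d > 1 of n+1 the polynomial G_d ∈ ℚ[z] is the reverse of Φ_d(X + 2) (equivalently, G_d(z) = z^{φ(d)}·Φ_d(2 + 1/z), with Φ_d the d-th cyclotomic polynomial and φ Euler's totient function); each G_d is irreducible in ℚ[z], and consequently Q_n(1,z,z) is irreducible in ℚ[z] if and only if n + 1 is prime. -/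
open MvPolynomial Polynomial

theorem Polynomial.natDegree_reverse_of_coeff_zero_ne_zero {R : Type*} [Semiring R]
    {f : Polynomial R} (h0 : f.coeff 0 ≠ 0) : f.reverse.natDegree = f.natDegree := by
  rw [reverse_natDegree, natTrailingDegree_eq_zero.2 (Or.inr h0), Nat.sub_zero]

theorem Polynomial.reverse_reverse_of_coeff_zero_ne_zero {R : Type*} [Semiring R]
    {f : Polynomial R} (h0 : f.coeff 0 ≠ 0) : f.reverse.reverse = f := by
  rw [reverse, natDegree_reverse_of_coeff_zero_ne_zero h0, reverse, reflect_reflect]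

theorem Polynomial.reverse_prod {R ι : Type*} [CommRing R] [IsDomain R] (s : Finset ι)
    (f : ι → Polynomial R) : (∏ i ∈ s, f i).reverse = ∏ i ∈ s, (f i).reverse := by
  classical
  induction s using Finset.induction_on with
  | empty => simpa using reverse_C (1 : R)
  | insert a s ha ih => rw [Finset.prod_insert ha, Finset.prod_insert ha, reverse_mul_of_domain, ih]

theorem Irreducible.polynomial_reverse {K : Type*} [Field K] {f : Polynomial K}
    (hf : Irreducible f) (h0 : f.coeff 0 ≠ 0) : Irreducible f.reverse := by
  have isUnit_of_reverse {a : Polynomial K} (ha0 : a.coeff 0 ≠ 0) (ha : IsUnit a.reverse) :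
      IsUnit a := by
    have ha' : a ≠ 0 := fun h => ha0 (by simp [h])
    rw [isUnit_iff_degree_eq_zero, degree_eq_natDegree ha',
      ← natDegree_reverse_of_coeff_zero_ne_zero ha0, natDegree_eq_zero_of_isUnit ha, Nat.cast_zero]
  refine ⟨fun hu => hf.not_isUnit (isUnit_of_reverse h0 hu), fun a b hab => ?_⟩
  have hab0 : a.coeff 0 * b.coeff 0 ≠ 0 := by
    rw [← mul_coeff_zero, ← hab, coeff_zero_reverse]
    exact leadingCoeff_ne_zero.2 hf.ne_zero
  have hfab : f = a.reverse * b.reverse := by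
    rw [← reverse_mul_of_domain, ← hab, reverse_reverse_of_coeff_zero_ne_zero h0]
  exact (hf.isUnit_or_isUnit hfab).imp (isUnit_of_reverse (left_ne_zero_of_mul hab0))
    (isUnit_of_reverse (right_ne_zero_of_mul hab0))

theorem Polynomial.irreducible_reverse_cyclotomic_comp {d : ℕ} (hd : 0 < d) :
    Irreducible (((cyclotomic d ℚ).comp (Polynomial.X + 2)).reverse) := by
  apply Irreducible.polynomial_reverse
  · have h := (MulEquiv.irreducible_iff (taylorEquiv (2 : ℚ))).2 (cyclotomic.irreducible_rat hd)
    have hcomp : taylorEquiv (2 : ℚ) (cyclotomic d ℚ) =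
        (cyclotomic d ℚ).comp (Polynomial.X + 2) := taylor_apply 2 _
    rwa [hcomp] at h
  · rw [coeff_zero_eq_eval_zero, eval_comp]
    simpa using (cyclotomic_pos' d (one_lt_two (α := ℚ))).ne'

theorem Polynomial.X_add_one_mul_prod_reverse_cyclotomic_comp {K : Type*} [Field K] {N : ℕ}
    (hN : 0 < N) :
    (1 + Polynomial.X) * ∏ d ∈ N.divisors.erase 1,
        ((cyclotomic d K).comp (Polynomial.X + 2)).reverse =
      (1 + 2 * Polynomial.X) ^ N - Polynomial.X ^ N := by
  have hC : (2 : Polynomial K) = C 2 := rfl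
  have hprod : (Polynomial.X + 1) * ∏ d ∈ N.divisors.erase 1,
      (cyclotomic d K).comp (Polynomial.X + 2) = (Polynomial.X + 2) ^ N - 1 := by
    rw [← prod_comp, prod_cyclotomic_eq_geom_sum hN]
    have h := congrArg (fun f : Polynomial K => f.comp (Polynomial.X + 2))
      (mul_geom_sum (Polynomial.X : Polynomial K) N)
    simp only [mul_comp, sub_comp, X_comp, one_comp, X_pow_comp] at h
    rw [← h]
    ring
  have hX (a : K) : reflect 1 (Polynomial.X + C a) = 1 + C a * Polynomial.X := by
    rw [reflect_add, reflect_one_X, reflect_C, pow_one]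
  have hpow (n : ℕ) : reflect n ((Polynomial.X + C (2 : K)) ^ n) = (1 + C 2 * Polynomial.X) ^ n := by
    induction n with
    | zero => simp
    | succ n ih =>
      rw [pow_succ, reflect_mul _ _ (natDegree_pow_X_add_C n 2).le (natDegree_X_add_C 2).le, ih,
        hX, pow_succ]
  have hdeg : ((Polynomial.X + C (2 : K)) ^ N - 1).natDegree = N := by
    rw [← C_1, natDegree_sub_C, natDegree_pow_X_add_C]
  have h1 : (Polynomial.X + 1 : Polynomial K).reverse = 1 + Polynomial.X := by
    rw [← C_1, reverse, natDegree_X_add_C, hX]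
    simp
  rw [← reverse_prod, ← h1, ← reverse_mul_of_domain, hprod, hC, reverse, hdeg, reflect_sub, hpow,
    reflect_one]

theorem one_add_mul_binary_overpartition_eq {R : Type*} [CommRing R] (z : R) (q : ℕ → R)
    (h0 : q 0 = 1) (h1 : q 1 = 1 + z)
    (heven : ∀ n, 1 ≤ n → q (2 * n) = q n + 2 * z * q (n - 1))
    (hodd : ∀ n, 1 ≤ n → q (2 * n + 1) = (1 + z) * q n + z * q (n - 1)) {m : ℕ} (hm : 1 ≤ m) :
    (1 + z) * q (2 ^ m - 1) = (1 + 2 * z) ^ m + z ^ (m + 1) ∧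
      (1 + z) * q (2 ^ m - 2) = (1 + 2 * z) ^ m - z ^ m := by
  induction m, hm using Nat.le_induction with
  | base => norm_num [h0, h1]; constructor <;> ring
  | succ m hm ih =>
    obtain ⟨ihR, ihQ⟩ := ih
    have hpow : 2 ≤ 2 ^ m := by simpa using Nat.pow_le_pow_right (n := 2) (by norm_num) hm
    rw [show 2 ^ m - 2 = (2 ^ m - 1) - 1 by omega] at ihQ
    rw [show 2 ^ (m + 1) - 1 = 2 * (2 ^ m - 1) + 1 by omega,
      show 2 ^ (m + 1) - 2 = 2 * (2 ^ m - 1) by omega, hodd _ (by omega), heven _ (by omega)]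
    constructor
    · linear_combination (1 + z) * ihR + z * ihQ
    · linear_combination ihR + 2 * z * ihQ

theorem irreducible_prod_divisors_erase_one_iff {M : Type*} [CommMonoid M] {N : ℕ} (hN : 2 ≤ N)
    {f : ℕ → M} (hf : ∀ d ∈ N.divisors.erase 1, Irreducible (f d)) :
    Irreducible (∏ d ∈ N.divisors.erase 1, f d) ↔ N.Prime := by
  constructor
  · intro h
    by_contra hp
    have hmin : N.minFac ∈ (N.divisors.erase 1).erase N := by
      simp only [Finset.mem_erase, Nat.mem_divisors]
      exact ⟨fun h => hp (h ▸ Nat.minFac_prime (by omega)), (Nat.minFac_prime (by omega)).ne_one,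
        N.minFac_dvd, by omega⟩
    have hmem : N ∈ N.divisors.erase 1 := by
      simp only [Finset.mem_erase, Nat.mem_divisors]
      exact ⟨by omega, dvd_rfl, by omega⟩
    rcases h.isUnit_or_isUnit (Finset.mul_prod_erase _ f hmem).symm with hu | hu
    · exact (hf N hmem).not_isUnit hu
    · exact (hf _ (Finset.mem_of_mem_erase hmin)).not_isUnit
        (isUnit_of_dvd_unit (Finset.dvd_prod_of_mem f hmin) hu)
  · intro hp
    rw [hp.divisors, Finset.erase_insert (by simpa using hp.ne_one.symm)] at hf ⊢
    simpa using hf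

/-- Proposition 5.7(a): in ℚ[z], `Q n (1,z,z)` factors as the product over the
divisors d ≠ 1 of n+1 of the (irreducible) reverses of `Φ_d(X+2)`; consequently
`Q n (1,z,z)` is irreducible over ℚ iff n+1 is prime. -/
theorem binary_overpartition_Q_one_z_z_factorization
    (p : ℕ → MvPolynomial (Fin 3) ℤ)
    (hp0 : p 0 = 1)
    (hp1 : p 1 = X 0 + X 1)
    (hpeven : ∀ n : ℕ, 1 ≤ n →
      p (2 * n) = p n + (X 2 + X 0 * X 1) * p (n - 1))
    (hpodd : ∀ n : ℕ, 1 ≤ n →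
      p (2 * n + 1) = (X 0 + X 1) * p n + X 0 * X 2 * p (n - 1)) :
    ∀ n : ℕ, 1 ≤ n →
      Polynomial.map (Int.castRingHom ℚ)
          (MvPolynomial.aeval ![1, Polynomial.X, Polynomial.X] (p (2 ^ (n + 1) - 2)) :
            Polynomial ℤ) =
        ∏ d ∈ (Nat.divisors (n + 1)).erase 1,
          ((Polynomial.cyclotomic d ℚ).comp (Polynomial.X + 2)).reverse ∧
      (∀ d ∈ (Nat.divisors (n + 1)).erase 1,
        Irreducible (((Polynomial.cyclotomic d ℚ).comp (Polynomial.X + 2)).reverse)) ∧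
      (Irreducible
          (Polynomial.map (Int.castRingHom ℚ)
            (MvPolynomial.aeval ![1, Polynomial.X, Polynomial.X] (p (2 ^ (n + 1) - 2)) :
              Polynomial ℤ)) ↔ (n + 1).Prime) := by
  intro n hn
  set φ : MvPolynomial (Fin 3) ℤ →+* Polynomial ℚ := (mapRingHom (Int.castRingHom ℚ)).comp
    (MvPolynomial.aeval ![1, Polynomial.X, Polynomial.X] :
      MvPolynomial (Fin 3) ℤ →ₐ[ℤ] Polynomial ℤ).toRingHom with hφ
  have hφX0 : φ (MvPolynomial.X 0) = 1 := by simp [hφ]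
  have hφX1 : φ (MvPolynomial.X 1) = Polynomial.X := by simp [hφ]
  have hφX2 : φ (MvPolynomial.X 2) = Polynomial.X := by simp [hφ]
  have hQ := (one_add_mul_binary_overpartition_eq Polynomial.X (fun k => φ (p k))
    (by simp [hp0]) (by simp only [hp1, map_add, hφX0, hφX1])
    (fun k hk => by
      simp only [hpeven k hk, map_add, map_mul, hφX0, hφX1, hφX2]
      ring)
    (fun k hk => by
      simp only [hpodd k hk, map_add, map_mul, hφX0, hφX1, hφX2]
      ring) (Nat.le_add_left 1 n)).2
  have hfac : φ (p (2 ^ (n + 1) - 2)) = ∏ d ∈ (Nat.divisors (n + 1)).erase 1,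
      ((Polynomial.cyclotomic d ℚ).comp (Polynomial.X + 2)).reverse := by
    have hne : (1 + Polynomial.X : Polynomial ℚ) ≠ 0 := by
      rw [add_comm, ← Polynomial.C_1]
      exact X_add_C_ne_zero 1
    exact mul_left_cancel₀ hne
      (hQ.trans (X_add_one_mul_prod_reverse_cyclotomic_comp n.succ_pos).symm)
  have hirr : ∀ d ∈ (Nat.divisors (n + 1)).erase 1,
      Irreducible (((Polynomial.cyclotomic d ℚ).comp (Polynomial.X + 2)).reverse) := fun d hd =>
    irreducible_reverse_cyclotomic_comp (Nat.pos_of_mem_divisors (Finset.mem_of_mem_erase hd))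
  change φ (p (2 ^ (n + 1) - 2)) = _ ∧ _ ∧ (Irreducible (φ (p (2 ^ (n + 1) - 2))) ↔ _)
  refine ⟨hfac, hirr, ?_⟩
  rw [hfac]
  exact irreducible_prod_divisors_erase_one_iff (by omega) hirr
end

section
/- For every n ≥ 1 and every complex number w, we have Q_n(1,w,w²) = 0 if and only if there exists a complex number ζ with ζ^{n+1} = 1, ζ ≠ 1, and w² + (1 − ζ)·w + 1 = 0. -/
open MvPolynomial

/-- The complete homogeneous sum `∑ xⁱ yⁿ⁻ⁱ` satisfies the recurrence with characteristic
roots `x` and `y`. -/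
theorem geom_sum₂_add_two {R : Type*} [CommRing R] (x y : R) (n : ℕ) :
    ∑ i ∈ Finset.range (n + 3), x ^ i * y ^ (n + 2 - i) =
      (x + y) * ∑ i ∈ Finset.range (n + 2), x ^ i * y ^ (n + 1 - i) -
        x * y * ∑ i ∈ Finset.range (n + 1), x ^ i * y ^ (n - i) := by
  have h1 := geom_sum₂_succ_eq x (y := y) (n := n + 2)
  have h2 := geom_sum₂_succ_eq x (y := y) (n := n + 1)
  simp only [Nat.add_sub_cancel, show n + 2 - 1 = n + 1 from rfl] at h1 h2
  rw [h1, h2]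
  ring

/-- Over `ℂ`, the sum `∑ xⁱ yⁿ⁻ⁱ` vanishes iff `x` is a nontrivial `(n+1)`-th root of unity
times `y`, provided `x` and `y` are not both zero. -/
theorem geom_sum₂_eq_zero_iff {x y : ℂ} (n : ℕ) (hxy : y = 0 → x ≠ 0) :
    ∑ i ∈ Finset.range (n + 1), x ^ i * y ^ (n - i) = 0 ↔
      ∃ ζ : ℂ, ζ ^ (n + 1) = 1 ∧ ζ ≠ 1 ∧ x = ζ * y := by
  have hmul := geom_sum₂_mul x y (n + 1)
  simp only [Nat.add_sub_cancel] at hmul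
  constructor
  · intro h
    rw [h, zero_mul, eq_comm, sub_eq_zero] at hmul
    have hy : y ≠ 0 := by
      intro hy
      rw [hy, zero_pow n.succ_ne_zero] at hmul
      exact hxy hy (pow_eq_zero_iff n.succ_ne_zero |>.mp hmul)
    refine ⟨x / y, ?_, ?_, (div_mul_cancel₀ x hy).symm⟩
    · rw [div_pow, hmul, div_self (pow_ne_zero _ hy)]
    · intro hζ
      obtain rfl : x = y := (div_eq_one_iff_eq hy).mp hζ
      have hself := geom_sum₂_self x (n + 1)
      simp only [Nat.add_sub_cancel] at hself
      rw [h] at hself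
      exact mul_ne_zero (Nat.cast_ne_zero.mpr n.succ_ne_zero) (pow_ne_zero n hy) hself.symm
  · rintro ⟨ζ, hζ, hζ1, rfl⟩
    have hy : y ≠ 0 := fun hy => hxy hy (by rw [hy, mul_zero])
    rw [mul_pow, hζ, one_mul, sub_self] at hmul
    refine (mul_eq_zero.mp hmul).resolve_right ?_
    rw [← sub_one_mul]
    exact mul_ne_zero (sub_ne_zero.mpr hζ1) hy

/-- Lemma 6.2: `Q n (1,w,w²) = 0` iff `w² + (1-ζ)w + 1 = 0` for some (n+1)-th root of
unity `ζ ≠ 1`. -/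
theorem binary_overpartition_Q_one_z_zsq_zeros
    (p : ℕ → MvPolynomial (Fin 3) ℤ)
    (hp0 : p 0 = 1)
    (hp1 : p 1 = X 0 + X 1)
    (hpeven : ∀ n : ℕ, 1 ≤ n →
      p (2 * n) = p n + (X 2 + X 0 * X 1) * p (n - 1))
    (hpodd : ∀ n : ℕ, 1 ≤ n →
      p (2 * n + 1) = (X 0 + X 1) * p n + X 0 * X 2 * p (n - 1)) :
    ∀ n : ℕ, 1 ≤ n → ∀ w : ℂ,
      MvPolynomial.aeval ![1, w, w ^ 2] (p (2 ^ (n + 1) - 2)) = 0 ↔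
        ∃ ζ : ℂ, ζ ^ (n + 1) = 1 ∧ ζ ≠ 1 ∧ w ^ 2 + (1 - ζ) * w + 1 = 0 := by
  intro n _ w
  set f : ℕ → ℂ := fun k => aeval ![1, w, w ^ 2] (p k) with hf
  have heven : ∀ k, 1 ≤ k → f (2 * k) = f k + (w ^ 2 + w) * f (k - 1) := by
    intro k hk
    simp [hf, hpeven k hk]
  have hodd : ∀ k, 1 ≤ k → f (2 * k + 1) = (1 + w) * f k + w ^ 2 * f (k - 1) := by
    intro k hk
    simp [hf, hpodd k hk]
  have hclosed : ∀ k : ℕ,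
      f (2 ^ (k + 1) - 2) =
        ∑ i ∈ Finset.range (k + 1), (w ^ 2 + w + 1) ^ i * w ^ (k - i) ∧
      f (2 ^ (k + 1) - 1) =
        ∑ i ∈ Finset.range (k + 2), (w ^ 2 + w + 1) ^ i * w ^ (k + 1 - i) -
          (w ^ 2 + w) * ∑ i ∈ Finset.range (k + 1), (w ^ 2 + w + 1) ^ i * w ^ (k - i) := by
    intro k
    induction k with
    | zero =>
      constructor
      · simp [hf, hp0]
      · simp [hf, hp1, Finset.sum_range_succ]
        ring
    | succ k ih =>
      obtain ⟨hQ, hR⟩ := ih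
      have hpos : 2 ≤ 2 ^ (k + 1) := Nat.le_self_pow k.succ_ne_zero 2
      have hpred : 2 ^ (k + 1) - 1 - 1 = 2 ^ (k + 1) - 2 := by omega
      have hE := heven (2 ^ (k + 1) - 1) (by omega)
      have hO := hodd (2 ^ (k + 1) - 1) (by omega)
      rw [hpred, hQ, hR] at hE hO
      constructor
      · rw [show 2 ^ (k + 1 + 1) - 2 = 2 * (2 ^ (k + 1) - 1) by rw [pow_succ]; omega, hE]
        ring
      · rw [show 2 ^ (k + 1 + 1) - 1 = 2 * (2 ^ (k + 1) - 1) + 1 by rw [pow_succ]; omega, hO,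
          geom_sum₂_add_two]
        ring
  change f (2 ^ (n + 1) - 2) = 0 ↔ _
  rw [(hclosed n).1, geom_sum₂_eq_zero_iff n (by rintro rfl; simp)]
  refine exists_congr fun ζ => and_congr_right fun _ => and_congr_right fun _ => ?_
  rw [← sub_eq_zero, show w ^ 2 + w + 1 - ζ * w = w ^ 2 + (1 - ζ) * w + 1 by ring]
end

section
/- For every n ≥ 1, if a complex number w = x + iy (with x, y real) satisfies Q_n(1,w,w²) = 0, then (x² + y² + x)² + (x + 1)² = 2y²; equivalently, all zeros of the polynomials Q_n(1,z,z²) lie on the quartic curve x⁴ + 2x²y² + y⁴ + 2x³ + 2xy² + 2x² − 2y² + 2x + 1 = 0. -/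
open MvPolynomial

/-- With `c = 1 + w + w²`, the values at `(1, w, w²)` of `p (2 ^ (n + 1) - 2)` and
`p (2 ^ (n + 1) - 1)`, multiplied by `c - w`, have closed forms in powers of `c` and `w`. -/
lemma sub_mul_aeval_binary_overpartition
    (p : ℕ → MvPolynomial (Fin 3) ℤ)
    (hp0 : p 0 = 1)
    (hp1 : p 1 = X 0 + X 1)
    (hpeven : ∀ n : ℕ, 1 ≤ n →
      p (2 * n) = p n + (X 2 + X 0 * X 1) * p (n - 1))
    (hpodd : ∀ n : ℕ, 1 ≤ n →
      p (2 * n + 1) = (X 0 + X 1) * p n + X 0 * X 2 * p (n - 1))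
    (w : ℂ) (n : ℕ) :
    (1 + w + w ^ 2 - w) * aeval ![1, w, w ^ 2] (p (2 ^ (n + 1) - 2)) =
        (1 + w + w ^ 2) ^ (n + 1) - w ^ (n + 1) ∧
      (1 + w + w ^ 2 - w) * aeval ![1, w, w ^ 2] (p (2 ^ (n + 1) - 1)) =
        (1 + w + w ^ 2) ^ (n + 1) + w ^ 2 * w ^ (n + 1) := by
  induction n with
  | zero =>
    simp only [zero_add, pow_one, Nat.sub_self, Nat.reduceSub, hp0, hp1, map_one, map_add, aeval_X,
      Matrix.cons_val_zero, Matrix.cons_val_one]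
    constructor <;> ring
  | succ n ih =>
    obtain ⟨hQ, hR⟩ := ih
    have hpos : 1 ≤ 2 ^ (n + 1) - 1 := by
      have := Nat.one_le_two_pow (n := n)
      omega
    have hsub : 2 ^ (n + 1) - 1 - 1 = 2 ^ (n + 1) - 2 := by omega
    have heven : 2 ^ (n + 1 + 1) - 2 = 2 * (2 ^ (n + 1) - 1) := by omega
    have hodd : 2 ^ (n + 1 + 1) - 1 = 2 * (2 ^ (n + 1) - 1) + 1 := by omega
    rw [heven, hodd, hpeven _ hpos, hpodd _ hpos, hsub]
    simp only [map_add, map_mul, aeval_X, Matrix.cons_val]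
    constructor
    · linear_combination hR + (w ^ 2 + w) * hQ
    · linear_combination (1 + w) * hR + w ^ 2 * hQ

/-- Proposition 6.3: every zero `w = x + iy` of `Q n (1,z,z²)` lies on the quartic
curve `(x²+y²+x)² + (x+1)² = 2y²`, equivalently
`x⁴+2x²y²+y⁴+2x³+2xy²+2x²-2y²+2x+1 = 0`. -/
theorem binary_overpartition_Q_one_z_zsq_zeros_on_quartic
    (p : ℕ → MvPolynomial (Fin 3) ℤ)
    (hp0 : p 0 = 1)
    (hp1 : p 1 = X 0 + X 1)
    (hpeven : ∀ n : ℕ, 1 ≤ n →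
      p (2 * n) = p n + (X 2 + X 0 * X 1) * p (n - 1))
    (hpodd : ∀ n : ℕ, 1 ≤ n →
      p (2 * n + 1) = (X 0 + X 1) * p n + X 0 * X 2 * p (n - 1)) :
    ∀ n : ℕ, 1 ≤ n → ∀ w : ℂ,
      MvPolynomial.aeval ![1, w, w ^ 2] (p (2 ^ (n + 1) - 2)) = 0 →
        (w.re ^ 2 + w.im ^ 2 + w.re) ^ 2 + (w.re + 1) ^ 2 = 2 * w.im ^ 2 ∧
        w.re ^ 4 + 2 * w.re ^ 2 * w.im ^ 2 + w.im ^ 4 + 2 * w.re ^ 3 +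
            2 * w.re * w.im ^ 2 + 2 * w.re ^ 2 - 2 * w.im ^ 2 + 2 * w.re + 1 = 0 := by
  intro n _ w hw
  have hQ := (sub_mul_aeval_binary_overpartition p hp0 hp1 hpeven hpodd w n).1
  rw [hw, mul_zero, eq_comm, sub_eq_zero] at hQ
  have hnorm : ‖1 + w + w ^ 2‖ = ‖w‖ := by
    refine (pow_left_inj₀ (norm_nonneg _) (norm_nonneg _) n.succ_ne_zero).mp ?_
    rw [← norm_pow, ← norm_pow, hQ]
  have hsq : Complex.normSq (1 + w + w ^ 2) = Complex.normSq w := by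
    rw [Complex.normSq_eq_norm_sq, Complex.normSq_eq_norm_sq, hnorm]
  simp only [Complex.normSq_apply, pow_two, Complex.add_re, Complex.add_im, Complex.mul_re,
    Complex.mul_im, Complex.one_re, Complex.one_im] at hsq
  constructor <;> linear_combination hsq
end

section
/- Every real point (x, y) on the quartic curve (x² + y² + x)² + (x + 1)² = 2y² satisfies 1/3 ≤ x² + y² ≤ 3; moreover, the maximal modulus √3 is attained exactly at the points (−1, √2) and (−1, −√2), and the minimal modulus 1/√3 is attained exactly at the points (−1/3, √2/3) and (−1/3, −√2/3), all of which lie on the curve. -/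
/-- On the quartic curve, `r = x² + y²` and `x` are related by a quadratic equation in `x`,
written here with the square completed. -/
theorem quartic_curve_discriminant {x y : ℝ}
    (h : (x ^ 2 + y ^ 2 + x) ^ 2 + (x + 1) ^ 2 = 2 * y ^ 2) :
    (4 * x + (x ^ 2 + y ^ 2) + 1) ^ 2 =
      (3 - (x ^ 2 + y ^ 2)) * (3 * (x ^ 2 + y ^ 2) - 1) := by
  linear_combination 4 * h

/-- Proposition 7.3: every real point (x,y) on the quartic curve
`(x²+y²+x)² + (x+1)² = 2y²` satisfies `1/3 ≤ x²+y² ≤ 3`; the maximal modulus √3 is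
attained exactly at `(-1, ±√2)` and the minimal modulus 1/√3 exactly at
`(-1/3, ±√2/3)`, and these four points lie on the curve. -/
theorem quartic_curve_modulus_bounds :
    (∀ x y : ℝ, (x ^ 2 + y ^ 2 + x) ^ 2 + (x + 1) ^ 2 = 2 * y ^ 2 →
      1 / 3 ≤ x ^ 2 + y ^ 2 ∧ x ^ 2 + y ^ 2 ≤ 3) ∧
    (∀ x y : ℝ, (x ^ 2 + y ^ 2 + x) ^ 2 + (x + 1) ^ 2 = 2 * y ^ 2 →
      (x ^ 2 + y ^ 2 = 3 ↔ x = -1 ∧ (y = Real.sqrt 2 ∨ y = -Real.sqrt 2))) ∧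
    (∀ x y : ℝ, (x ^ 2 + y ^ 2 + x) ^ 2 + (x + 1) ^ 2 = 2 * y ^ 2 →
      (x ^ 2 + y ^ 2 = 1 / 3 ↔
        x = -(1 / 3) ∧ (y = Real.sqrt 2 / 3 ∨ y = -(Real.sqrt 2 / 3)))) ∧
    (((-1 : ℝ) ^ 2 + Real.sqrt 2 ^ 2 + (-1)) ^ 2 + ((-1 : ℝ) + 1) ^ 2 =
        2 * Real.sqrt 2 ^ 2) ∧
    (((-1 : ℝ) ^ 2 + (-Real.sqrt 2) ^ 2 + (-1)) ^ 2 + ((-1 : ℝ) + 1) ^ 2 =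
        2 * (-Real.sqrt 2) ^ 2) ∧
    (((-(1 / 3) : ℝ) ^ 2 + (Real.sqrt 2 / 3) ^ 2 + (-(1 / 3))) ^ 2 +
        ((-(1 / 3) : ℝ) + 1) ^ 2 = 2 * (Real.sqrt 2 / 3) ^ 2) ∧
    (((-(1 / 3) : ℝ) ^ 2 + (-(Real.sqrt 2 / 3)) ^ 2 + (-(1 / 3))) ^ 2 +
        ((-(1 / 3) : ℝ) + 1) ^ 2 = 2 * (-(Real.sqrt 2 / 3)) ^ 2) := by
  have hs : Real.sqrt 2 ^ 2 = 2 := Real.sq_sqrt (by norm_num)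
  refine ⟨fun x y h => ?_, fun x y h => ⟨fun hr => ?_, ?_⟩, fun x y h => ⟨fun hr => ?_, ?_⟩,
    ?_, ?_, ?_, ?_⟩
  · have hd := quartic_curve_discriminant h
    have hsq := sq_nonneg (4 * x + (x ^ 2 + y ^ 2) + 1)
    constructor <;> nlinarith
  · have hd := quartic_curve_discriminant h
    rw [hr] at hd
    have hx : x = -1 := by
      have : 4 * x + 3 + 1 = 0 := pow_eq_zero_iff two_ne_zero |>.mp (by linarith)
      linarith
    subst hx
    exact ⟨rfl, sq_eq_sq_iff_eq_or_eq_neg.mp (by linarith)⟩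
  · rintro ⟨rfl, rfl | rfl⟩ <;> linear_combination hs
  · have hd := quartic_curve_discriminant h
    rw [hr] at hd
    have hx : x = -(1 / 3) := by
      have : 4 * x + 1 / 3 + 1 = 0 := pow_eq_zero_iff two_ne_zero |>.mp (by linarith)
      linarith
    subst hx
    exact ⟨rfl, sq_eq_sq_iff_eq_or_eq_neg.mp (by linarith)⟩
  · rintro ⟨rfl, rfl | rfl⟩ <;> linear_combination hs / 9
  all_goals
    simp only [neg_sq, div_pow, hs]
    norm_num
end
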